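/- arXiv:2303.11789 — 6 statements merged into one kernel-verified Lean document; each statement's English description precedes it below -/
import Mathlib

section
/- For the decentralized online learning algorithm in the reproducing kernel Hilbert space H_K, suppose 𝒢 is connected, Assumptions A3, A4, A5 and Conditions C1, C2, C3 hold, and the sequences {(x₁(k), …, x_N(k)), k ≥ 0} and {(v₁(k), …, v_N(k)), k ≥ 0} are both i.i.d. and mutually independent. If the operator E[∑_{j=1}^N K_{x_j(0)} ⊗ K_{x_j(0)}] ∈ L(H_K) is strictly positive (⟨E[∑_j K_{x_j(0)} ⊗ K_{x_j(0)}] f, f⟩_K > 0 for every f ≠ 0), then the algorithm is both mean square consistent and almost surely strongly consistent. -/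
open MeasureTheory ProbabilityTheory Filter ENNReal RealInnerProductSpace

noncomputable section

/-- The rank-one operator `φ ⊗ ψ ∈ L(H)`, `(φ ⊗ ψ) f = ⟪f, ψ⟫ φ`. -/
def rankOne {H : Type*} [NormedAddCommGroup H] [InnerProductSpace ℝ H] (φ ψ : H) : H →L[ℝ] H :=
  (innerSL ℝ ψ).smulRight φ

/-- The σ-algebra `𝓕(k−1)` generated by the random variables `f(x_i(s)) = ⟪f, K_{x_i(s)}⟫`
(`f ∈ H_K`, `i ∈ V`) and `v_i(s)` (`i ∈ V`) for `0 ≤ s ≤ k−1` (so `rkhsFilt Kx xi v 0` is the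
trivial σ-algebra `𝓕(−1)`). -/
def rkhsFilt {Ω S HK : Type*} [MeasurableSpace Ω]
    [NormedAddCommGroup HK] [InnerProductSpace ℝ HK]
    {N : ℕ} (Kx : S → HK) (xi : Fin N → ℕ → Ω → S) (v : Fin N → ℕ → Ω → ℝ) (k : ℕ) :
    MeasurableSpace Ω :=
  ⨆ s ∈ Finset.range k, ⨆ i : Fin N,
    ((⨆ g : HK, MeasurableSpace.comap (fun ω => ⟪g, Kx (xi i s ω)⟫) (borel ℝ)) ⊔
      MeasurableSpace.comap (fun ω => v i s ω) (borel ℝ))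

section PositiveOperator

variable {E : Type*} [NormedAddCommGroup E] [InnerProductSpace ℝ E] {M : E →L[ℝ] E}

lemma inner_map_sub_smul_le (hsymm : ∀ x y, ⟪M x, y⟫ = ⟪x, M y⟫)
    {t : ℝ} (ht : 0 ≤ t) (htM : t * ‖M‖ ≤ 1) (x : E) :
    ⟪M (x - t • M x), x - t • M x⟫ ≤ ⟪M x, x⟫ - t * ‖M x‖ ^ 2 := by
  have h1 : ⟪M (x - t • M x), x - t • M x⟫
      = ⟪M x, x⟫ - 2 * t * ‖M x‖ ^ 2 + t ^ 2 * ⟪M (M x), M x⟫ := by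
    simp only [map_sub, map_smul, inner_sub_left, inner_sub_right, inner_smul_left,
      inner_smul_right, hsymm (M x) x, real_inner_self_eq_norm_sq, conj_trivial]
    ring
  have h2 : ⟪M (M x), M x⟫ ≤ ‖M‖ * ‖M x‖ ^ 2 := by
    calc ⟪M (M x), M x⟫ ≤ ‖M (M x)‖ * ‖M x‖ := real_inner_le_norm _ _
      _ ≤ (‖M‖ * ‖M x‖) * ‖M x‖ := by gcongr; exact M.le_opNorm _
      _ = _ := by ring
  have h3 : t ^ 2 * ⟪M (M x), M x⟫ ≤ t * ‖M x‖ ^ 2 := by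
    calc t ^ 2 * ⟪M (M x), M x⟫ ≤ t ^ 2 * (‖M‖ * ‖M x‖ ^ 2) := by gcongr
      _ = (t * ‖M‖) * (t * ‖M x‖ ^ 2) := by ring
      _ ≤ 1 * (t * ‖M x‖ ^ 2) := by gcongr
      _ = _ := one_mul _
  linarith

lemma mul_norm_sq_le_inner_of_mul_norm_le_one (hsymm : ∀ x y, ⟪M x, y⟫ = ⟪x, M y⟫)
    (hpos : ∀ x, 0 ≤ ⟪M x, x⟫) {t : ℝ} (ht : 0 ≤ t) (htM : t * ‖M‖ ≤ 1) (x : E) :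
    t * ‖M x‖ ^ 2 ≤ ⟪M x, x⟫ := by
  linarith [inner_map_sub_smul_le hsymm ht htM x, hpos (x - t • M x)]

lemma norm_sub_smul_sq (t : ℝ) (x : E) :
    ‖x - t • M x‖ ^ 2 = ‖x‖ ^ 2 - 2 * t * ⟪M x, x⟫ + t ^ 2 * ‖M x‖ ^ 2 := by
  rw [norm_sub_sq_real, inner_smul_right, norm_smul, real_inner_comm, mul_pow, Real.norm_eq_abs,
    sq_abs]
  ring

lemma norm_sub_smul_sq_le (hsymm : ∀ x y, ⟪M x, y⟫ = ⟪x, M y⟫)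
    (hpos : ∀ x, 0 ≤ ⟪M x, x⟫) {t : ℝ} (ht : 0 ≤ t) (htM : t * ‖M‖ ≤ 1) (x : E) :
    ‖x - t • M x‖ ^ 2 ≤ ‖x‖ ^ 2 - t * ⟪M x, x⟫ := by
  have h := mul_le_mul_of_nonneg_left
    (mul_norm_sq_le_inner_of_mul_norm_le_one hsymm hpos ht htM x) ht
  rw [norm_sub_smul_sq]
  linarith

lemma norm_sub_smul_le (hsymm : ∀ x y, ⟪M x, y⟫ = ⟪x, M y⟫)
    (hpos : ∀ x, 0 ≤ ⟪M x, x⟫) {t : ℝ} (ht : 0 ≤ t) (htM : t * ‖M‖ ≤ 1) (x : E) :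
    ‖x - t • M x‖ ≤ ‖x‖ := by
  refine (sq_le_sq₀ (norm_nonneg _) (norm_nonneg _)).1 ?_
  have := norm_sub_smul_sq_le hsymm hpos ht htM x
  have := mul_nonneg ht (hpos x)
  linarith

/-- The product `(1 - a (k-1) M) ⋯ (1 - a 0 M)`. -/
def gradientProduct (M : E →L[ℝ] E) (a : ℕ → ℝ) : ℕ → E →L[ℝ] E
  | 0 => 1
  | k + 1 => (1 - a k • M) * gradientProduct M a k

lemma gradientProduct_zero_apply (a : ℕ → ℝ) (x : E) : gradientProduct M a 0 x = x := rfl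

lemma gradientProduct_succ_apply (a : ℕ → ℝ) (k : ℕ) (x : E) :
    gradientProduct M a (k + 1) x
      = gradientProduct M a k x - a k • M (gradientProduct M a k x) := rfl

lemma gradientProduct_map (a : ℕ → ℝ) (k : ℕ) (x : E) :
    gradientProduct M a k (M x) = M (gradientProduct M a k x) := by
  induction k with
  | zero => rfl
  | succ k ih => simp only [gradientProduct_succ_apply, ih, map_sub, map_smul]

lemma norm_gradientProduct_apply_le (hsymm : ∀ x y, ⟪M x, y⟫ = ⟪x, M y⟫)
    (hpos : ∀ x, 0 ≤ ⟪M x, x⟫) {a : ℕ → ℝ} (ha : ∀ k, 0 < a k) (haM : ∀ k, a k * ‖M‖ ≤ 1)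
    (k : ℕ) (x : E) : ‖gradientProduct M a k x‖ ≤ ‖x‖ := by
  induction k with
  | zero => rfl
  | succ k ih => exact (norm_sub_smul_le hsymm hpos (ha k).le (haM k) _).trans ih

lemma tendsto_map_gradientProduct (hsymm : ∀ x y, ⟪M x, y⟫ = ⟪x, M y⟫)
    (hpos : ∀ x, 0 ≤ ⟪M x, x⟫) {a : ℕ → ℝ} (ha : ∀ k, 0 < a k) (haM : ∀ k, a k * ‖M‖ ≤ 1)
    (hsum : ¬ Summable a) (x : E) :
    Tendsto (fun k => M (gradientProduct M a k x)) atTop (nhds 0) := by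
  set r : ℕ → E := fun k => gradientProduct M a k x
  set q : ℕ → ℝ := fun k => ⟪M (r k), r k⟫
  have hanti : Antitone q := antitone_nat_of_succ_le fun k =>
    (inner_map_sub_smul_le hsymm (ha k).le (haM k) (r k)).trans
      (sub_le_self _ (mul_nonneg (ha k).le (sq_nonneg _)))
  have hq0 : ∀ k, 0 ≤ q k := fun k => hpos _
  have hsumq : ∀ k, ∑ j ∈ Finset.range k, a j * q j ≤ ‖x‖ ^ 2 - ‖r k‖ ^ 2 := by
    intro k
    induction k with
    | zero => simp [r, gradientProduct_zero_apply]
    | succ k ih =>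
      rw [Finset.sum_range_succ]
      have : ‖r (k + 1)‖ ^ 2 ≤ ‖r k‖ ^ 2 - a k * q k :=
        norm_sub_smul_sq_le hsymm hpos (ha k).le (haM k) (r k)
      linarith
  have hbdd : BddBelow (Set.range q) := ⟨0, by rintro _ ⟨k, rfl⟩; exact hq0 k⟩
  have hlim := tendsto_atTop_ciInf hanti hbdd
  have hinf : ⨅ k, q k = 0 := by
    by_contra hne
    have hℓ : 0 < ⨅ k, q k := lt_of_le_of_ne (le_ciInf hq0) (Ne.symm hne)
    refine hsum (summable_of_sum_range_le (c := ‖x‖ ^ 2 / ⨅ k, q k) (fun k => (ha k).le)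
      fun k => ?_)
    rw [le_div_iff₀ hℓ, Finset.sum_mul]
    calc ∑ j ∈ Finset.range k, a j * ⨅ k, q k ≤ ∑ j ∈ Finset.range k, a j * q j :=
          Finset.sum_le_sum fun j _ => mul_le_mul_of_nonneg_left (ciInf_le hbdd j) (ha j).le
      _ ≤ _ := hsumq k
      _ ≤ _ := by linarith [sq_nonneg ‖r k‖]
  rw [hinf] at hlim
  have hsq : Tendsto (fun k => ‖M (r k)‖ ^ 2) atTop (nhds 0) := by
    refine squeeze_zero (fun k => by positivity) (fun k => ?_)
      (by simpa using hlim.const_mul (a 0)⁻¹)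
    rw [inv_mul_eq_div, le_div_iff₀ (ha 0), mul_comm]
    exact mul_norm_sq_le_inner_of_mul_norm_le_one hsymm hpos (ha 0).le (haM 0) (r k)
  rw [tendsto_zero_iff_norm_tendsto_zero]
  simpa using hsq.sqrt

lemma inner_map_nonneg_of_pos (hinj : ∀ x ≠ 0, 0 < ⟪M x, x⟫) (x : E) : 0 ≤ ⟪M x, x⟫ := by
  rcases eq_or_ne x 0 with rfl | hx
  · simp
  · exact (hinj x hx).le

lemma denseRange_of_inner_map_pos [CompleteSpace E]
    (hinj : ∀ x ≠ 0, 0 < ⟪M x, x⟫) : DenseRange M := by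
  have : M.range.topologicalClosure = ⊤ := by
    rw [Submodule.topologicalClosure_eq_top_iff, Submodule.eq_bot_iff]
    intro y hy
    by_contra hne
    exact (hinj y hne).ne' (hy _ ⟨y, rfl⟩)
  exact Submodule.dense_iff_topologicalClosure_eq_top.2 this

/-- If `M` is a strictly positive self-adjoint operator and `∑ a k = ∞`, the products
`(1 - a (k-1) M) ⋯ (1 - a 0 M)` converge strongly to `0`. -/
theorem tendsto_gradientProduct_apply [CompleteSpace E] (hsymm : ∀ x y, ⟪M x, y⟫ = ⟪x, M y⟫)
    (hinj : ∀ x ≠ 0, 0 < ⟪M x, x⟫) {a : ℕ → ℝ} (ha : ∀ k, 0 < a k)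
    (haM : ∀ k, a k * ‖M‖ ≤ 1) (hsum : ¬ Summable a) (x : E) :
    Tendsto (fun k => gradientProduct M a k x) atTop (nhds 0) := by
  have hpos : ∀ x, 0 ≤ ⟪M x, x⟫ := inner_map_nonneg_of_pos hinj
  rw [Metric.tendsto_atTop]
  intro ε hε
  obtain ⟨z, hz⟩ := (denseRange_of_inner_map_pos hinj).exists_dist_lt x (half_pos hε)
  obtain ⟨k₀, hk₀⟩ := Metric.tendsto_atTop.1
    (tendsto_map_gradientProduct hsymm hpos ha haM hsum z) (ε / 2) (half_pos hε)
  refine ⟨k₀, fun k hk => ?_⟩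
  have h1 := hk₀ k hk
  rw [dist_zero_right] at h1 ⊢
  have h2 : gradientProduct M a k x
      = gradientProduct M a k (x - M z) + M (gradientProduct M a k z) := by
    rw [← gradientProduct_map, ← map_add, sub_add_cancel]
  have h3 := norm_gradientProduct_apply_le hsymm hpos ha haM k (x - M z)
  rw [dist_eq_norm] at hz
  rw [h2]
  linarith [norm_add_le (gradientProduct M a k (x - M z)) (M (gradientProduct M a k z))]

end PositiveOperator

section MeanSquare

variable {Ω E : Type*} {mΩ : MeasurableSpace Ω} {P : Measure Ω}
  [NormedAddCommGroup E] [InnerProductSpace ℝ E]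

lemma integrable_inner_of_memLp_two {u w : Ω → E} (hu : MemLp u 2 P) (hw : MemLp w 2 P) :
    Integrable (fun ω => ⟪u ω, w ω⟫) P :=
  (hu.norm.integrable_mul hw.norm).mono' (hu.1.inner hw.1)
    (ae_of_all _ fun ω => norm_inner_le_norm (u ω) (w ω))

lemma condExp_inner_eq_zero [CompleteSpace E] [IsFiniteMeasure P] {𝒜 : MeasurableSpace Ω}
    {u w : Ω → E} (hu : MemLp u 2 P) (hw : MemLp w 2 P) (hmeas : StronglyMeasurable[𝒜] u)
    (hzero : P[w | 𝒜] =ᵐ[P] 0) : P[fun ω => ⟪u ω, w ω⟫ | 𝒜] =ᵐ[P] 0 := by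
  have h := condExp_bilin_of_stronglyMeasurable_left (innerSL ℝ) hmeas
    (integrable_inner_of_memLp_two hu hw) (hw.integrable one_le_two)
  filter_upwards [h, hzero] with ω h1 h2
  refine h1.trans ?_
  rw [h2]
  simp

lemma integral_inner_eq_zero [CompleteSpace E] [IsFiniteMeasure P] {𝒜 : MeasurableSpace Ω}
    (h𝒜 : 𝒜 ≤ mΩ) {u w : Ω → E} (hu : MemLp u 2 P) (hw : MemLp w 2 P)
    (hmeas : StronglyMeasurable[𝒜] u) (hzero : P[w | 𝒜] =ᵐ[P] 0) : ∫ ω, ⟪u ω, w ω⟫ ∂P = 0 := by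
  rw [← integral_condExp h𝒜, integral_congr_ae (condExp_inner_eq_zero hu hw hmeas hzero)]
  simp

lemma integral_norm_add_smul_sq [CompleteSpace E] [IsFiniteMeasure P] {𝒜 : MeasurableSpace Ω}
    (h𝒜 : 𝒜 ≤ mΩ) {u w : Ω → E} (hu : MemLp u 2 P) (hw : MemLp w 2 P)
    (hmeas : StronglyMeasurable[𝒜] u) (hzero : P[w | 𝒜] =ᵐ[P] 0) (t : ℝ) :
    ∫ ω, ‖u ω + t • w ω‖ ^ 2 ∂P = ∫ ω, ‖u ω‖ ^ 2 ∂P + t ^ 2 * ∫ ω, ‖w ω‖ ^ 2 ∂P := by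
  have hexp : ∀ ω, ‖u ω + t • w ω‖ ^ 2
      = ‖u ω‖ ^ 2 + 2 * t * ⟪u ω, w ω⟫ + t ^ 2 * ‖w ω‖ ^ 2 := fun ω => by
    rw [norm_add_sq_real, inner_smul_right, norm_smul, mul_pow, Real.norm_eq_abs, sq_abs]
    ring
  have hu2 := (memLp_two_iff_integrable_sq_norm hu.1).1 hu
  have hw2 := (memLp_two_iff_integrable_sq_norm hw.1).1 hw
  have hi := integrable_inner_of_memLp_two hu hw
  simp_rw [hexp]
  rw [integral_add (hu2.fun_add (hi.const_mul _)) (hw2.const_mul _),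
    integral_add hu2 (hi.const_mul _), integral_const_mul, integral_const_mul,
    integral_inner_eq_zero h𝒜 hu hw hmeas hzero]
  ring

lemma eLpNorm_one_le_of_integral_abs_le {Y : ℕ → Ω → ℝ} {R : ℝ} (hY : ∀ k, Integrable (Y k) P)
    (hR : ∀ k, ∫ ω, |Y k ω| ∂P ≤ R) (k : ℕ) : eLpNorm (Y k) 1 P ≤ R.toNNReal := by
  rw [eLpNorm_one_eq_lintegral_enorm, ← ofReal_integral_norm_eq_lintegral_enorm (hY k)]
  exact ENNReal.ofReal_le_ofReal (hR k)

/-- A form of the Robbins–Siegmund almost supermartingale convergence theorem. -/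
theorem ae_exists_tendsto_of_le_add [IsFiniteMeasure P] {𝒢 : Filtration ℕ mΩ}
    {Y ρ z : ℕ → Ω → ℝ} {R R' : ℝ}
    (hYmeas : ∀ k, StronglyMeasurable[𝒢 k] (Y k)) (hYint : ∀ k, Integrable (Y k) P)
    (hYnonneg : ∀ k ω, 0 ≤ Y k ω) (hYbdd : ∀ k, ∫ ω, Y k ω ∂P ≤ R)
    (hρmeas : ∀ k, StronglyMeasurable[𝒢 (k + 1)] (ρ k)) (hρint : ∀ k, Integrable (ρ k) P)
    (hρnonneg : ∀ k ω, 0 ≤ ρ k ω) (hρbdd : ∀ k, ∑ j ∈ Finset.range k, ∫ ω, ρ j ω ∂P ≤ R')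
    (hzint : ∀ k, Integrable (z k) P) (hz : ∀ k, P[z k | 𝒢 k] =ᵐ[P] 0)
    (hle : ∀ k ω, Y (k + 1) ω ≤ Y k ω + ρ k ω + z k ω) :
    ∀ᵐ ω ∂P, ∃ l, Tendsto (fun k => Y k ω) atTop (nhds l) := by
  set T : ℕ → Ω → ℝ := fun k ω => ∑ j ∈ Finset.range k, ρ j ω
  have hTsucc : ∀ k ω, T (k + 1) ω = T k ω + ρ k ω := fun k ω => Finset.sum_range_succ _ _
  have hTmeas : StronglyAdapted 𝒢 T := fun k => Finset.stronglyMeasurable_fun_sum _ fun j hj =>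
    (hρmeas j).mono (𝒢.mono (Finset.mem_range.1 hj))
  have hTint : ∀ k, Integrable (T k) P := fun k => integrable_finsetSum _ fun j _ => hρint j
  have hTnonneg : ∀ k ω, 0 ≤ T k ω := fun k ω => Finset.sum_nonneg fun j _ => hρnonneg j ω
  have hTbdd : ∀ k, ∫ ω, T k ω ∂P ≤ R' := fun k => by
    rw [integral_finsetSum _ fun j _ => hρint j]
    exact hρbdd k
  have hTsub : Submartingale T 𝒢 P := by
    refine submartingale_of_condExp_sub_nonneg_nat hTmeas hTint fun k => ?_
    refine condExp_nonneg (ae_of_all _ fun ω => ?_)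
    simpa [hTsucc] using hρnonneg k ω
  have hWsub : Submartingale (fun k ω => T k ω - Y k ω) 𝒢 P := by
    refine submartingale_of_condExp_sub_nonneg_nat (fun k => (hTmeas k).sub (hYmeas k))
      (fun k => (hTint k).sub (hYint k)) fun k => ?_
    have h1 : P[-z k | 𝒢 k] ≤ᵐ[P]
        P[(fun ω => T (k + 1) ω - Y (k + 1) ω) - (fun ω => T k ω - Y k ω) | 𝒢 k] := by
      refine condExp_mono (hzint k).neg
        (((hTint _).sub (hYint _)).sub ((hTint _).sub (hYint _))) (ae_of_all _ fun ω => ?_)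
      simp only [Pi.neg_apply, Pi.sub_apply, hTsucc]
      linarith [hle k ω]
    filter_upwards [h1, condExp_neg (z k) (𝒢 k), hz k] with ω h2 h3 h4
    rw [h3, Pi.neg_apply, h4] at h2
    simpa using h2
  have hT := hTsub.exists_ae_tendsto_of_bdd (eLpNorm_one_le_of_integral_abs_le (R := R')
    hTint fun k => by
    simp_rw [abs_of_nonneg (hTnonneg k _)]
    exact hTbdd k)
  have hW := hWsub.exists_ae_tendsto_of_bdd
    (eLpNorm_one_le_of_integral_abs_le (R := R' + R) (fun k => (hTint k).sub (hYint k)) fun k => by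
      calc ∫ ω, |T k ω - Y k ω| ∂P ≤ ∫ ω, (T k ω + Y k ω) ∂P := by
            refine integral_mono ((hTint k).sub (hYint k)).abs ((hTint k).add (hYint k))
              fun ω => ?_
            have h1 := hTnonneg k ω
            have h2 := hYnonneg k ω
            exact abs_le.2 ⟨by linarith, by linarith⟩
        _ ≤ R' + R := by
            rw [integral_add (hTint k) (hYint k)]
            exact add_le_add (hTbdd k) (hYbdd k))
  filter_upwards [hT, hW] with ω ⟨l₁, h₁⟩ ⟨l₂, h₂⟩
  exact ⟨l₁ - l₂, by simpa using h₁.sub h₂⟩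

end MeanSquare

section StochasticApproximation

variable {Ω E : Type*} {mΩ : MeasurableSpace Ω} {P : Measure Ω} {𝒢 : Filtration ℕ mΩ}
  [NormedAddCommGroup E] [InnerProductSpace ℝ E]
  {M : E →L[ℝ] E} {a c : ℕ → ℝ} {B : ℝ} {e δ w : ℕ → Ω → E}

/-- The linear recursion `e (k+1) = (1 - a k M) e k + δ k + a k w k`, where `δ` is a predictable
perturbation of relative size `c` and `w` is a square integrable martingale difference
sequence. -/
structure IsStochasticApproximation (P : Measure Ω) (𝒢 : Filtration ℕ mΩ) (M : E →L[ℝ] E)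
    (a c : ℕ → ℝ) (B : ℝ) (e δ w : ℕ → Ω → E) : Prop where
  step : ∀ k ω, e (k + 1) ω = e k ω - a k • M (e k ω) + δ k ω + a k • w k ω
  memLp : ∀ k, MemLp (e k) 2 P
  stronglyMeasurable : ∀ k, StronglyMeasurable[𝒢 k] (e k)
  stronglyMeasurable_perturbation : ∀ k, StronglyMeasurable[𝒢 k] (δ k)
  norm_perturbation_le : ∀ k ω, ‖δ k ω‖ ≤ c k * ‖e k ω‖
  memLp_noise : ∀ k, MemLp (w k) 2 P
  stronglyMeasurable_noise : ∀ k, StronglyMeasurable[𝒢 (k + 1)] (w k)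
  condExp_noise : ∀ k, P[w k | 𝒢 k] =ᵐ[P] 0
  integral_norm_noise_sq_le : ∀ k, ∫ ω, ‖w k ω‖ ^ 2 ∂P ≤ B * (1 + ∫ ω, ‖e k ω‖ ^ 2 ∂P)

lemma norm_add_sq_le_of_norm_le {F : Type*} [NormedAddCommGroup F] [InnerProductSpace ℝ F]
    {p d x : F} {t s : ℝ} (ht : 0 ≤ t) (hts : t ≤ s) (hd : ‖d‖ ≤ t * ‖x‖) :
    ‖p + d‖ ^ 2 ≤ (1 + t) * ‖p‖ ^ 2 + (1 + s) * t * ‖x‖ ^ 2 := by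
  have h1 : ‖p + d‖ ^ 2 ≤ (‖p‖ + t * ‖x‖) ^ 2 := by
    gcongr
    exact (norm_add_le _ _).trans (by gcongr)
  have h2 : 0 ≤ t * (‖p‖ - ‖x‖) ^ 2 := by positivity
  have h3 : t * t * ‖x‖ ^ 2 ≤ s * t * ‖x‖ ^ 2 := by gcongr
  linarith

lemma exists_forall_le_of_le_add_mul {D η : ℕ → ℝ} (hD : ∀ k, 0 ≤ D k) (hη : ∀ k, 0 ≤ η k)
    (hsum : Summable η) (hstep : ∀ k, D (k + 1) ≤ D k + η k * (1 + D k)) :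
    ∃ R, ∀ k, D k ≤ R := by
  have h1 : ∀ k, 1 + D k ≤ (1 + D 0) * Real.exp (∑ j ∈ Finset.range k, η j) := by
    intro k
    induction k with
    | zero => simp
    | succ k ih =>
      rw [Finset.sum_range_succ, Real.exp_add, ← mul_assoc]
      calc 1 + D (k + 1) ≤ (1 + D k) * (η k + 1) := by linarith [hstep k]
        _ ≤ _ := by
          have h2 := hD 0
          have h3 := hη k
          exact mul_le_mul ih (Real.add_one_le_exp _) (by positivity) (by positivity)
  refine ⟨(1 + D 0) * Real.exp (∑' j, η j), fun k => ?_⟩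
  have h2 : (1 + D 0) * Real.exp (∑ j ∈ Finset.range k, η j)
      ≤ (1 + D 0) * Real.exp (∑' j, η j) := by
    have := hD 0
    gcongr
    exact hsum.sum_le_tsum _ fun j _ => hη j
  linarith [h1 k]

namespace IsStochasticApproximation

variable (h : IsStochasticApproximation P 𝒢 M a c B e δ w)

include h

lemma memLp_perturbation (k : ℕ) : MemLp (δ k) 2 P :=
  (h.memLp k).of_le_mul ((h.stronglyMeasurable_perturbation k).mono (𝒢.le k)).aestronglyMeasurable
    (ae_of_all _ (h.norm_perturbation_le k))

lemma integrable_norm_sq (k : ℕ) : Integrable (fun ω => ‖e k ω‖ ^ 2) P :=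
  (memLp_two_iff_integrable_sq_norm (h.memLp k).1).1 (h.memLp k)

lemma integrable_norm_noise_sq (k : ℕ) : Integrable (fun ω => ‖w k ω‖ ^ 2) P :=
  (memLp_two_iff_integrable_sq_norm (h.memLp_noise k).1).1 (h.memLp_noise k)

lemma memLp_predictor (k : ℕ) : MemLp (fun ω => e k ω - a k • M (e k ω) + δ k ω) 2 P :=
  ((h.memLp k).sub ((M.comp_memLp' (h.memLp k)).const_smul (a k))).add (h.memLp_perturbation k)

lemma stronglyMeasurable_predictor (k : ℕ) :
    StronglyMeasurable[𝒢 k] (fun ω => e k ω - a k • M (e k ω) + δ k ω) :=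
  ((h.stronglyMeasurable k).sub
    ((M.continuous.comp_stronglyMeasurable (h.stronglyMeasurable k)).const_smul (a k))).add
    (h.stronglyMeasurable_perturbation k)

lemma norm_predictor_sq_le (hpos : ∀ x, 0 ≤ ⟪M x, x⟫) (ha : ∀ k, 0 < a k)
    {s : ℝ} (hc : ∀ k, 0 ≤ c k) (hcs : ∀ k, c k ≤ s) (k : ℕ) (ω : Ω) :
    ‖e k ω - a k • M (e k ω) + δ k ω‖ ^ 2
      ≤ ‖e k ω‖ ^ 2 + ((1 + s) * ‖M‖ ^ 2 * a k ^ 2 + (2 + s) * c k) * ‖e k ω‖ ^ 2 := by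
  have h1 := norm_add_sq_le_of_norm_le (p := e k ω - a k • M (e k ω)) (hc k) (hcs k)
    (h.norm_perturbation_le k ω)
  have h2 : ‖e k ω - a k • M (e k ω)‖ ^ 2 ≤ (1 + a k ^ 2 * ‖M‖ ^ 2) * ‖e k ω‖ ^ 2 := by
    rw [norm_sub_smul_sq]
    have h3 : ‖M (e k ω)‖ ^ 2 ≤ (‖M‖ * ‖e k ω‖) ^ 2 := by gcongr; exact M.le_opNorm _
    have h4 := mul_nonneg (ha k).le (hpos (e k ω))
    have h5 := mul_le_mul_of_nonneg_left h3 (sq_nonneg (a k))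
    linarith
  have h6 := mul_le_mul_of_nonneg_left h2 (add_nonneg zero_le_one (hc k))
  have h7 : c k * (a k ^ 2 * ‖M‖ ^ 2 * ‖e k ω‖ ^ 2) ≤ s * (a k ^ 2 * ‖M‖ ^ 2 * ‖e k ω‖ ^ 2) := by
    gcongr
    exact hcs k
  linarith

lemma integral_norm_sq_succ_eq [CompleteSpace E] [IsFiniteMeasure P] (k : ℕ) :
    ∫ ω, ‖e (k + 1) ω‖ ^ 2 ∂P = ∫ ω, ‖e k ω - a k • M (e k ω) + δ k ω‖ ^ 2 ∂P
      + a k ^ 2 * ∫ ω, ‖w k ω‖ ^ 2 ∂P := by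
  rw [← integral_norm_add_smul_sq (𝒢.le k) (h.memLp_predictor k) (h.memLp_noise k)
    (h.stronglyMeasurable_predictor k) (h.condExp_noise k)]
  simp_rw [h.step]

lemma exists_integral_norm_sq_le [CompleteSpace E] [IsFiniteMeasure P]
    (hpos : ∀ x, 0 ≤ ⟪M x, x⟫) (ha : ∀ k, 0 < a k) (ha2 : Summable fun k => a k ^ 2)
    (hc : ∀ k, 0 ≤ c k) (hcsum : Summable c) (hB : 0 ≤ B) :
    ∃ R, ∀ k, ∫ ω, ‖e k ω‖ ^ 2 ∂P ≤ R := by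
  have hcs : ∀ k, c k ≤ ∑' j, c j := fun k => hcsum.le_tsum k fun j _ => hc j
  set s := ∑' j, c j
  have hs : 0 ≤ s := (hc 0).trans (hcs 0)
  refine exists_forall_le_of_le_add_mul
    (η := fun k => (1 + s) * ‖M‖ ^ 2 * a k ^ 2 + (2 + s) * c k + B * a k ^ 2)
    (fun k => by positivity) (fun k => ?_)
    (((ha2.mul_left _).add (hcsum.mul_left _)).add (ha2.mul_left _)) fun k => ?_
  · have := hc k
    positivity
  · rw [h.integral_norm_sq_succ_eq]
    have h1 : ∫ ω, ‖e k ω - a k • M (e k ω) + δ k ω‖ ^ 2 ∂P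
        ≤ ∫ ω, (‖e k ω‖ ^ 2
          + ((1 + s) * ‖M‖ ^ 2 * a k ^ 2 + (2 + s) * c k) * ‖e k ω‖ ^ 2) ∂P :=
      integral_mono ((memLp_two_iff_integrable_sq_norm (h.memLp_predictor k).1).1
        (h.memLp_predictor k)) ((h.integrable_norm_sq k).add
          ((h.integrable_norm_sq k).const_mul _)) (h.norm_predictor_sq_le hpos ha hc hcs k)
    rw [integral_add (h.integrable_norm_sq k) ((h.integrable_norm_sq k).const_mul _),
      integral_const_mul] at h1
    have h2 := mul_le_mul_of_nonneg_left (h.integral_norm_noise_sq_le k) (sq_nonneg (a k))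
    have h3 : 0 ≤ (1 + s) * ‖M‖ ^ 2 * a k ^ 2 + (2 + s) * c k := by
      have := hc k
      positivity
    linarith

/-- The distance in mean square to the noiseless iteration restarted at time `n`. -/
lemma integral_norm_sub_gradientProduct_sq_le [CompleteSpace E] [IsFiniteMeasure P]
    (hsymm : ∀ x y, ⟪M x, y⟫ = ⟪x, M y⟫) (hpos : ∀ x, 0 ≤ ⟪M x, x⟫) (ha : ∀ k, 0 < a k)
    (hc : ∀ k, 0 ≤ c k) {s : ℝ} (hcs : ∀ k, c k ≤ s) (hB : 0 ≤ B) {R : ℝ}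
    (hR : ∀ k, ∫ ω, ‖e k ω‖ ^ 2 ∂P ≤ R) {n : ℕ} (haM : ∀ k, a (n + k) * ‖M‖ ≤ 1) (k : ℕ) :
    ∫ ω, ‖e (n + k) ω - gradientProduct M (fun j => a (n + j)) k (e n ω)‖ ^ 2 ∂P
      ≤ ∑ j ∈ Finset.range k,
        ((5 + s) * R * c (n + j) + B * (1 + R) * a (n + j) ^ 2) := by
  induction k with
  | zero => simp [gradientProduct_zero_apply]
  | succ k ih =>
    set r : Ω → E := fun ω => gradientProduct M (fun j => a (n + j)) k (e n ω) with hr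
    set d : Ω → E := fun ω => e (n + k) ω - r ω with hd
    set u : Ω → E := fun ω => d ω - a (n + k) • M (d ω) + δ (n + k) ω with hu
    have hs : 0 ≤ s := (hc 0).trans (hcs 0)
    have hrLp : MemLp r 2 P := (gradientProduct M (fun j => a (n + j)) k).comp_memLp' (h.memLp n)
    have hrmeas : StronglyMeasurable[𝒢 (n + k)] r :=
      (gradientProduct M (fun j => a (n + j)) k).continuous.comp_stronglyMeasurable
        ((h.stronglyMeasurable n).mono (𝒢.mono (Nat.le_add_right n k)))
    have hdLp : MemLp d 2 P := (h.memLp (n + k)).sub hrLp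
    have hdmeas : StronglyMeasurable[𝒢 (n + k)] d := (h.stronglyMeasurable (n + k)).sub hrmeas
    have huLp : MemLp u 2 P := (hdLp.sub ((M.comp_memLp' hdLp).const_smul _)).add
      (h.memLp_perturbation (n + k))
    have humeas : StronglyMeasurable[𝒢 (n + k)] u :=
      (hdmeas.sub ((M.continuous.comp_stronglyMeasurable hdmeas).const_smul _)).add
        (h.stronglyMeasurable_perturbation (n + k))
    have hstep : ∀ ω, e (n + (k + 1)) ω
        - gradientProduct M (fun j => a (n + j)) (k + 1) (e n ω)
        = u ω + a (n + k) • w (n + k) ω := fun ω => by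
      rw [← add_assoc, h.step, gradientProduct_succ_apply]
      simp only [hu, hd, hr, map_sub, smul_sub]
      abel
    have hd2 := (memLp_two_iff_integrable_sq_norm hdLp.1).1 hdLp
    have he2 := h.integrable_norm_sq
    have hu2 : ∫ ω, ‖u ω‖ ^ 2 ∂P
        ≤ (1 + c (n + k)) * ∫ ω, ‖d ω‖ ^ 2 ∂P
          + (1 + s) * c (n + k) * ∫ ω, ‖e (n + k) ω‖ ^ 2 ∂P := by
      rw [← integral_const_mul, ← integral_const_mul,
        ← integral_add (hd2.const_mul _) ((he2 _).const_mul _)]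
      refine integral_mono ((memLp_two_iff_integrable_sq_norm huLp.1).1 huLp)
        ((hd2.const_mul _).add ((he2 _).const_mul _)) fun ω => ?_
      refine (norm_add_sq_le_of_norm_le (hc _) (hcs _)
        (h.norm_perturbation_le (n + k) ω)).trans ?_
      have := hc (n + k)
      gcongr
      exact norm_sub_smul_le hsymm hpos (ha _).le (haM k) _
    have hd4 : ∫ ω, ‖d ω‖ ^ 2 ∂P ≤ 4 * R := by
      have h1 : ∫ ω, ‖d ω‖ ^ 2 ∂P ≤ ∫ ω, (2 * ‖e (n + k) ω‖ ^ 2 + 2 * ‖e n ω‖ ^ 2) ∂P := by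
        refine integral_mono hd2 (((he2 _).const_mul _).add ((he2 _).const_mul _)) fun ω => ?_
        have h2 := norm_gradientProduct_apply_le hsymm hpos (fun j => ha (n + j)) haM k (e n ω)
        have h3 : ‖d ω‖ ^ 2 ≤ (‖e (n + k) ω‖ + ‖e n ω‖) ^ 2 := by
          gcongr
          exact (norm_sub_le _ _).trans (by gcongr)
        dsimp only
        linarith [sq_nonneg (‖e (n + k) ω‖ - ‖e n ω‖)]
      rw [integral_add ((he2 _).const_mul _) ((he2 _).const_mul _), integral_const_mul,
        integral_const_mul] at h1
      linarith [hR (n + k), hR n]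
    simp_rw [hstep]
    rw [integral_norm_add_smul_sq (𝒢.le _) huLp (h.memLp_noise _) humeas (h.condExp_noise _),
      Finset.sum_range_succ]
    have h1 := mul_le_mul_of_nonneg_left hd4 (hc (n + k))
    have h2 := mul_le_mul_of_nonneg_left (hR (n + k))
      (mul_nonneg (add_nonneg zero_le_one hs) (hc (n + k)))
    have h3 := mul_le_mul_of_nonneg_left ((h.integral_norm_noise_sq_le (n + k)).trans
      (mul_le_mul_of_nonneg_left (add_le_add_right (hR (n + k)) 1) hB)) (sq_nonneg (a (n + k)))
    linarith

theorem tendsto_integral_norm_sq [CompleteSpace E] [IsFiniteMeasure P]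
    (hsymm : ∀ x y, ⟪M x, y⟫ = ⟪x, M y⟫) (hinj : ∀ x ≠ 0, 0 < ⟪M x, x⟫) (ha : ∀ k, 0 < a k)
    (hasum : ¬ Summable a) (ha2 : Summable fun k => a k ^ 2)
    (hc : ∀ k, 0 ≤ c k) (hcsum : Summable c) (hB : 0 ≤ B) :
    Tendsto (fun k => ∫ ω, ‖e k ω‖ ^ 2 ∂P) atTop (nhds 0) := by
  have hpos : ∀ x, 0 ≤ ⟪M x, x⟫ := inner_map_nonneg_of_pos hinj
  have hcs : ∀ k, c k ≤ ∑' j, c j := fun k => hcsum.le_tsum k fun j _ => hc j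
  obtain ⟨R, hR⟩ := h.exists_integral_norm_sq_le hpos ha ha2 hc hcsum hB
  have hR0 : 0 ≤ R := le_trans (by positivity) (hR 0)
  have hs : 0 ≤ ∑' j, c j := tsum_nonneg hc
  set θ : ℕ → ℝ := fun k => (5 + ∑' j, c j) * R * c k + B * (1 + R) * a k ^ 2 with hθ
  have hθ0 : ∀ k, 0 ≤ θ k := fun k => by
    have := hc k
    positivity
  have hθsum : Summable θ := (hcsum.mul_left _).add (ha2.mul_left _)
  have ha0 : Tendsto a atTop (nhds 0) := by
    have := ha2.tendsto_atTop_zero.sqrt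
    simpa [Real.sqrt_sq (ha _).le] using this
  rw [Metric.tendsto_atTop]
  intro ε hε
  have htail : ∀ᶠ n in atTop, ∑' k, θ (k + n) < ε / 4 :=
    (tendsto_sum_nat_add θ).eventually_lt_const (by positivity)
  have hsmall : ∀ᶠ n in atTop, ∀ k ≥ n, a k * ‖M‖ ≤ 1 := by
    rw [eventually_forall_ge_atTop]
    have h1 : Tendsto (fun k => a k * ‖M‖) atTop (nhds 0) := by simpa using ha0.mul_const ‖M‖
    exact h1.eventually_le_const zero_lt_one
  obtain ⟨n, hn, hnM⟩ := (htail.and hsmall).exists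
  replace hnM : ∀ k, a (n + k) * ‖M‖ ≤ 1 := fun k => hnM _ (Nat.le_add_right n k)
  have hnsum : ¬ Summable fun k => a (n + k) := by
    simpa only [add_comm n, summable_nat_add_iff] using hasum
  set r : ℕ → Ω → E := fun k ω => gradientProduct M (fun j => a (n + j)) k (e n ω) with hr
  have hrLp : ∀ k, MemLp (r k) 2 P := fun k =>
    (gradientProduct M (fun j => a (n + j)) k).comp_memLp' (h.memLp n)
  have hr2 : ∀ k, Integrable (fun ω => ‖r k ω‖ ^ 2) P := fun k =>
    (memLp_two_iff_integrable_sq_norm (hrLp k).1).1 (hrLp k)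
  have hrlim : Tendsto (fun k => ∫ ω, ‖r k ω‖ ^ 2 ∂P) atTop (nhds 0) := by
    rw [← integral_zero Ω ℝ (μ := P)]
    refine tendsto_integral_of_dominated_convergence (fun ω => ‖e n ω‖ ^ 2) (fun k => (hr2 k).1)
      (h.integrable_norm_sq n) (fun k => ae_of_all _ fun ω => ?_) (ae_of_all _ fun ω => ?_)
    · rw [norm_pow, norm_norm]
      gcongr
      exact norm_gradientProduct_apply_le hsymm hpos (fun j => ha (n + j)) hnM k (e n ω)
    · have := (tendsto_gradientProduct_apply hsymm hinj (fun j => ha (n + j)) hnM hnsum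
        (e n ω)).norm.pow 2
      simpa using this
  obtain ⟨k₀, hk₀⟩ := eventually_atTop.1
    (hrlim.eventually_lt_const (show (0 : ℝ) < ε / 4 by positivity))
  refine ⟨n + k₀, fun k' hk' => ?_⟩
  obtain ⟨k, rfl⟩ := Nat.exists_eq_add_of_le (le_of_add_le_left hk')
  have hk : k₀ ≤ k := Nat.le_of_add_le_add_left hk'
  have h1 := h.integral_norm_sub_gradientProduct_sq_le hsymm hpos ha hc hcs hB hR hnM k
  have h2 : ∑ j ∈ Finset.range k, θ (n + j) ≤ ∑' j, θ (j + n) := by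
    simp_rw [add_comm n]
    exact ((summable_nat_add_iff n).2 hθsum).sum_le_tsum _ fun j _ => hθ0 _
  have hd2 : Integrable (fun ω => ‖e (n + k) ω - r k ω‖ ^ 2) P :=
    (memLp_two_iff_integrable_sq_norm ((h.memLp (n + k)).sub (hrLp k)).1).1
      ((h.memLp (n + k)).sub (hrLp k))
  have h3 : ∫ ω, ‖e (n + k) ω‖ ^ 2 ∂P
      ≤ ∫ ω, (2 * ‖e (n + k) ω - r k ω‖ ^ 2 + 2 * ‖r k ω‖ ^ 2) ∂P := by
    refine integral_mono (h.integrable_norm_sq _) ((hd2.const_mul 2).add ((hr2 k).const_mul 2))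
      fun ω => ?_
    have h4 : ‖e (n + k) ω‖ ^ 2 ≤ (‖e (n + k) ω - r k ω‖ + ‖r k ω‖) ^ 2 := by
      gcongr
      exact norm_le_norm_sub_add _ _
    dsimp only
    linarith [sq_nonneg (‖e (n + k) ω - r k ω‖ - ‖r k ω‖)]
  rw [integral_add (hd2.const_mul 2) ((hr2 k).const_mul 2), integral_const_mul,
    integral_const_mul] at h3
  rw [Real.dist_0_eq_abs, abs_of_nonneg (by positivity)]
  have h5 := hk₀ k hk
  have h6 : ∫ ω, ‖e (n + k) ω - r k ω‖ ^ 2 ∂P ≤ ∑ j ∈ Finset.range k, θ (n + j) := h1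
  linarith

theorem ae_tendsto_norm [CompleteSpace E] [IsFiniteMeasure P]
    (hsymm : ∀ x y, ⟪M x, y⟫ = ⟪x, M y⟫) (hinj : ∀ x ≠ 0, 0 < ⟪M x, x⟫) (ha : ∀ k, 0 < a k)
    (hasum : ¬ Summable a) (ha2 : Summable fun k => a k ^ 2)
    (hc : ∀ k, 0 ≤ c k) (hcsum : Summable c) (hB : 0 ≤ B) :
    ∀ᵐ ω ∂P, Tendsto (fun k => ‖e k ω‖) atTop (nhds 0) := by
  have hpos : ∀ x, 0 ≤ ⟪M x, x⟫ := inner_map_nonneg_of_pos hinj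
  have hcs : ∀ k, c k ≤ ∑' j, c j := fun k => hcsum.le_tsum k fun j _ => hc j
  set s := ∑' j, c j
  have hs : 0 ≤ s := (hc 0).trans (hcs 0)
  obtain ⟨R, hR⟩ := h.exists_integral_norm_sq_le hpos ha ha2 hc hcsum hB
  have hR0 : 0 ≤ R := le_trans (by positivity) (hR 0)
  set γ : ℕ → ℝ := fun k => (1 + s) * ‖M‖ ^ 2 * a k ^ 2 + (2 + s) * c k
  have hγ0 : ∀ k, 0 ≤ γ k := fun k => by
    have := hc k
    positivity
  have hγsum : Summable γ := (ha2.mul_left _).add (hcsum.mul_left _)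
  set u : ℕ → Ω → E := fun k ω => e k ω - a k • M (e k ω) + δ k ω
  have hconv : ∀ᵐ ω ∂P, ∃ l, Tendsto (fun k => ‖e k ω‖ ^ 2) atTop (nhds l) := by
    refine ae_exists_tendsto_of_le_add (𝒢 := 𝒢) (R := R)
      (R' := ∑' k, (R * γ k + B * (1 + R) * a k ^ 2))
      (ρ := fun k ω => γ k * ‖e k ω‖ ^ 2 + a k ^ 2 * ‖w k ω‖ ^ 2)
      (z := fun k ω => (2 * a k) * ⟪u k ω, w k ω⟫)
      (fun k => (h.stronglyMeasurable k).norm.pow 2) h.integrable_norm_sq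
      (fun k ω => by positivity) hR (fun k => ?_)
      (fun k => ((h.integrable_norm_sq k).const_mul _).add
        ((h.integrable_norm_noise_sq k).const_mul _))
      (fun k ω => by have := hγ0 k; positivity) (fun k => ?_)
      (fun k => (integrable_inner_of_memLp_two (h.memLp_predictor k)
        (h.memLp_noise k)).const_mul _) (fun k => ?_) fun k ω => ?_
    · exact ((((h.stronglyMeasurable k).mono (𝒢.mono k.le_succ)).norm.pow 2).const_mul _).add
        (((h.stronglyMeasurable_noise k).norm.pow 2).const_mul _)
    · have hsum : Summable fun k => R * γ k + B * (1 + R) * a k ^ 2 :=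
        (hγsum.mul_left _).add (ha2.mul_left _)
      refine (Finset.sum_le_sum fun j _ => ?_).trans (hsum.sum_le_tsum (Finset.range k)
        fun j _ => by have := hγ0 j; positivity)
      rw [integral_add ((h.integrable_norm_sq j).const_mul _)
        ((h.integrable_norm_noise_sq j).const_mul _), integral_const_mul, integral_const_mul]
      have h1 := mul_le_mul_of_nonneg_left (hR j) (hγ0 j)
      have h2 := mul_le_mul_of_nonneg_left ((h.integral_norm_noise_sq_le j).trans
        (mul_le_mul_of_nonneg_left (add_le_add_right (hR j) 1) hB)) (sq_nonneg (a j))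
      linarith
    · filter_upwards [condExp_smul (2 * a k) (fun ω => ⟪u k ω, w k ω⟫) (𝒢 k) (μ := P),
        condExp_inner_eq_zero (h.memLp_predictor k) (h.memLp_noise k)
          (h.stronglyMeasurable_predictor k) (h.condExp_noise k)] with ω h1 h2
      refine h1.trans ?_
      rw [Pi.smul_apply, h2]
      simp
    · have h1 := h.norm_predictor_sq_le hpos ha hc hcs k ω
      have h2 : ‖e (k + 1) ω‖ ^ 2
          = ‖u k ω‖ ^ 2 + 2 * a k * ⟪u k ω, w k ω⟫ + a k ^ 2 * ‖w k ω‖ ^ 2 := by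
        rw [h.step, norm_add_sq_real, inner_smul_right, norm_smul, mul_pow, Real.norm_eq_abs,
          sq_abs]
        ring
      linarith
  have hmeas : TendstoInMeasure P (fun k ω => ‖e k ω‖ ^ 2) atTop fun _ => 0 := by
    refine tendstoInMeasure_of_tendsto_eLpNorm one_ne_zero
      (fun k => (h.integrable_norm_sq k).1) aestronglyMeasurable_const ?_
    have h1 : ∀ k, eLpNorm ((fun ω => ‖e k ω‖ ^ 2) - fun _ => 0) 1 P
        = ENNReal.ofReal (∫ ω, ‖e k ω‖ ^ 2 ∂P) := fun k => by
      rw [eLpNorm_one_eq_lintegral_enorm,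
        ← ofReal_integral_norm_eq_lintegral_enorm ((h.integrable_norm_sq k).sub (by simp))]
      simp
    simp_rw [h1]
    simpa using ENNReal.tendsto_ofReal
      (h.tendsto_integral_norm_sq hsymm hinj ha hasum ha2 hc hcsum hB)
  obtain ⟨ns, hns, hlim⟩ := hmeas.exists_seq_tendsto_ae
  filter_upwards [hconv, hlim] with ω ⟨l, hl⟩ h0
  have hl0 : l = 0 := tendsto_nhds_unique (hl.comp hns.tendsto_atTop) h0
  rw [hl0] at hl
  simpa using hl.sqrt

end IsStochasticApproximation

end StochasticApproximation

section Independence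

variable {Ω E : Type*} {mΩ : MeasurableSpace Ω} {P : Measure Ω}
  [NormedAddCommGroup E] [NormedSpace ℝ E] [CompleteSpace E]

lemma iIndep_sumElim {ι κ : Type*} {m : ι → MeasurableSpace Ω} {m' : κ → MeasurableSpace Ω}
    (hm : iIndep m P) (hm' : iIndep m' P) (h : Indep (⨆ i, m i) (⨆ j, m' j) P) :
    iIndep (Sum.elim m m') P := by
  rw [iIndep_iff]
  intro s f hf
  have hl : ∀ i ∈ s.toLeft, MeasurableSet[m i] (f (Sum.inl i)) := fun i hi =>
    hf (Sum.inl i) (Finset.mem_toLeft.1 hi)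
  have hr : ∀ j ∈ s.toRight, MeasurableSet[m' j] (f (Sum.inr j)) := fun j hj =>
    hf (Sum.inr j) (Finset.mem_toRight.1 hj)
  have hsplit : ⋂ x ∈ s, f x
      = (⋂ i ∈ s.toLeft, f (Sum.inl i)) ∩ ⋂ j ∈ s.toRight, f (Sum.inr j) := by
    ext ω
    simp [Sum.forall]
  rw [hsplit, Finset.prod_sum_eq_prod_toLeft_mul_prod_toRight, ← hm.meas_biInter hl,
    ← hm'.meas_biInter hr]
  refine (Indep_iff _ _ _).1 h _ _ ?_ ?_
  · exact Finset.measurableSet_biInter _ fun i hi => le_iSup m i _ (hl i hi)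
  · exact Finset.measurableSet_biInter _ fun j hj => le_iSup m' j _ (hr j hj)

/-- The σ-algebras generated by the terms of index `< k` of a sequence of σ-algebras. -/
def strictPast (m : ℕ → MeasurableSpace Ω) (hm : ∀ k, m k ≤ mΩ) : Filtration ℕ mΩ where
  seq k := ⨆ j ∈ Set.Iio k, m j
  mono' _ _ hkl := biSup_mono fun _ hj => lt_of_lt_of_le hj hkl
  le' _ := iSup₂_le fun j _ => hm j

lemma le_strictPast {m : ℕ → MeasurableSpace Ω} (hm : ∀ k, m k ≤ mΩ) {j k : ℕ} (hjk : j < k) :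
    m j ≤ strictPast m hm k :=
  le_iSup₂_of_le (f := fun i (_ : i ∈ Set.Iio k) => m i) j hjk le_rfl

variable {m m' : ℕ → MeasurableSpace Ω}

lemma strictPast_sup_le (hmm : ∀ k, m k ⊔ m' k ≤ mΩ) {k : ℕ} {T : Set (ℕ ⊕ ℕ)}
    (hT : ∀ j < k, Sum.inl j ∈ T ∧ Sum.inr j ∈ T) :
    strictPast (fun k => m k ⊔ m' k) hmm k ≤ ⨆ p ∈ T, Sum.elim m m' p :=
  iSup₂_le fun j hj => sup_le (le_iSup₂_of_le (f := fun p (_ : p ∈ T) => Sum.elim m m' p)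
    (Sum.inl j) (hT j hj).1 le_rfl) (le_iSup₂_of_le (f := fun p (_ : p ∈ T) => Sum.elim m m' p)
    (Sum.inr j) (hT j hj).2 le_rfl)

lemma indep_strictPast_of_iIndep (hmm : ∀ k, m k ⊔ m' k ≤ mΩ)
    (hind : iIndep (Sum.elim m m') P) (k : ℕ) :
    Indep (m k) (strictPast (fun k => m k ⊔ m' k) hmm k) P := by
  have hle : ∀ p, Sum.elim m m' p ≤ mΩ :=
    Sum.rec (fun j => le_sup_left.trans (hmm j)) fun j => le_sup_right.trans (hmm j)
  have hdisj : Disjoint {Sum.inl k} {p : ℕ ⊕ ℕ | p.elim id id < k} := by simp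
  have := indep_iSup_of_disjoint hle hind hdisj
  rw [iSup_singleton] at this
  exact indep_of_indep_of_le_right this (strictPast_sup_le hmm fun j hj => ⟨hj, hj⟩)

lemma indep_strictPast_sup_of_iIndep (hmm : ∀ k, m k ⊔ m' k ≤ mΩ)
    (hind : iIndep (Sum.elim m m') P) (k : ℕ) :
    Indep (m' k) (strictPast (fun k => m k ⊔ m' k) hmm k ⊔ m k) P := by
  have hle : ∀ p, Sum.elim m m' p ≤ mΩ :=
    Sum.rec (fun j => le_sup_left.trans (hmm j)) fun j => le_sup_right.trans (hmm j)
  have hdisj : Disjoint {Sum.inr k} {p : ℕ ⊕ ℕ | p.elim id id < k ∨ p = Sum.inl k} := by simp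
  have := indep_iSup_of_disjoint hle hind hdisj
  rw [iSup_singleton] at this
  refine indep_of_indep_of_le_right this (sup_le ?_ ?_)
  · exact strictPast_sup_le hmm fun j hj => ⟨Or.inl hj, Or.inl hj⟩
  · exact le_iSup₂_of_le (f := fun p (_ : p ∈ {p : ℕ ⊕ ℕ | p.elim id id < k ∨ p = Sum.inl k}) =>
      Sum.elim m m' p) (Sum.inl k) (Or.inr rfl) le_rfl

variable {m₁ m₂ : MeasurableSpace Ω} [IsFiniteMeasure P]

lemma condExp_smul_eq_zero_of_indep (hm₁ : m₁ ≤ mΩ) (hm₂ : m₂ ≤ mΩ) (hind : Indep m₁ m₂ P)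
    {v : Ω → ℝ} {φ : Ω → E} (hv : StronglyMeasurable[m₁] v) (hφ : StronglyMeasurable[m₂] φ)
    (hv_int : Integrable v P) (hvφ : Integrable (fun ω => v ω • φ ω) P)
    (hv_zero : ∫ ω, v ω ∂P = 0) : P[fun ω => v ω • φ ω | m₂] =ᵐ[P] 0 := by
  filter_upwards [condExp_bilin_of_stronglyMeasurable_right (ContinuousLinearMap.lsmul ℝ ℝ)
    hφ hvφ hv_int, condExp_indep_eq hm₁ hm₂ hv hind] with ω h1 h2
  simp only [ContinuousLinearMap.lsmul_apply] at h1
  rw [h1, h2, hv_zero, zero_smul, Pi.zero_apply]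

lemma condExp_clm_apply_of_indep (hm₁ : m₁ ≤ mΩ) (hm₂ : m₂ ≤ mΩ) (hind : Indep m₁ m₂ P)
    {T : Ω → E →L[ℝ] E} {e : Ω → E} (hT : StronglyMeasurable[m₁] T)
    (he : StronglyMeasurable[m₂] e) (hT_int : Integrable T P)
    (hTe : Integrable (fun ω => T ω (e ω)) P) :
    P[fun ω => T ω (e ω) | m₂] =ᵐ[P] fun ω => (∫ ω', T ω' ∂P) (e ω) := by
  filter_upwards [condExp_bilin_of_stronglyMeasurable_right (ContinuousLinearMap.id ℝ (E →L[ℝ] E))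
    he hTe hT_int, condExp_indep_eq hm₁ hm₂ hT hind] with ω h1 h2
  simp only [ContinuousLinearMap.id_apply] at h1
  rw [h1, h2]

end Independence

section RandomLinearRecursion

variable {Ω E ι : Type*} {mΩ : MeasurableSpace Ω} {P : Measure Ω} [Fintype ι]
  [NormedAddCommGroup E] [InnerProductSpace ℝ E]
  {m m' : ℕ → MeasurableSpace Ω} {L : E →L[ℝ] E} {a b : ℕ → ℝ} {R κ β : ℝ}
  {T : ℕ → Ω → E →L[ℝ] E} {φ : ι → ℕ → Ω → E} {v : ι → ℕ → Ω → ℝ} {e : ℕ → Ω → E}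

/-- The recursion `e (k + 1) = e k - a k • (T k (e k) - ∑ i, v i k • φ i k) - b k • L (e k)`, driven
by bounded random data `T k`, `φ i k` measurable for `m k` and square integrable centred noises
`v i k` measurable for `m' k`, where the σ-algebras `m k`, `m' k` are all independent and the
mean of `T k` does not depend on `k`. -/
structure IsRandomLinearRecursion (P : Measure Ω) (m m' : ℕ → MeasurableSpace Ω) (L : E →L[ℝ] E)
    (a b : ℕ → ℝ) (R κ β : ℝ) (T : ℕ → Ω → E →L[ℝ] E) (φ : ι → ℕ → Ω → E) (v : ι → ℕ → Ω → ℝ)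
    (e : ℕ → Ω → E) : Prop where
  le : ∀ k, m k ⊔ m' k ≤ mΩ
  iIndep : iIndep (Sum.elim m m') P
  init : ∃ c, ∀ ω, e 0 ω = c
  step : ∀ k ω, e (k + 1) ω
    = e k ω - a k • T k ω (e k ω) + a k • (∑ i, v i k ω • φ i k ω) - b k • L (e k ω)
  stronglyMeasurable_operator : ∀ k, StronglyMeasurable[m k] (T k)
  norm_operator_le : ∀ k ω, ‖T k ω‖ ≤ R
  integral_operator : ∀ k, ∫ ω, T k ω ∂P = ∫ ω, T 0 ω ∂P
  stronglyMeasurable_direction : ∀ i k, StronglyMeasurable[m k] (φ i k)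
  norm_direction_le : ∀ i k ω, ‖φ i k ω‖ ≤ κ
  stronglyMeasurable_noise : ∀ i k, StronglyMeasurable[m' k] (v i k)
  memLp_noise : ∀ i k, MemLp (v i k) 2 P
  integral_noise : ∀ i k, ∫ ω, v i k ω ∂P = 0
  integral_noise_sq_le : ∀ i k, ∫ ω, v i k ω ^ 2 ∂P ≤ β

namespace IsRandomLinearRecursion

variable (h : IsRandomLinearRecursion P m m' L a b R κ β T φ v e)
include h

lemma stronglyMeasurable_apply {m₀ : MeasurableSpace Ω} {k : ℕ} (hmk : m k ≤ m₀)
    (he : StronglyMeasurable[m₀] (e k)) :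
    StronglyMeasurable[m₀] fun ω => T k ω (e k ω) :=
  isBoundedBilinearMap_apply.continuous.comp_stronglyMeasurable
    (((h.stronglyMeasurable_operator k).mono hmk).prodMk he)

lemma stronglyMeasurable_noise_sum {m₀ : MeasurableSpace Ω} {k : ℕ} (hmk : m k ⊔ m' k ≤ m₀) :
    StronglyMeasurable[m₀] fun ω => ∑ i, v i k ω • φ i k ω :=
  Finset.stronglyMeasurable_fun_sum _ fun i _ =>
    ((h.stronglyMeasurable_noise i k).mono (le_sup_right.trans hmk)).smul
      ((h.stronglyMeasurable_direction i k).mono (le_sup_left.trans hmk))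

lemma stronglyMeasurable (k : ℕ) :
    StronglyMeasurable[strictPast (fun k => m k ⊔ m' k) h.le k] (e k) := by
  induction k with
  | zero =>
    obtain ⟨c, hc⟩ := h.init
    rw [show e 0 = fun _ => c from funext hc]
    exact stronglyMeasurable_const
  | succ k ih =>
    have hle := le_strictPast h.le k.lt_succ_self
    have he := ih.mono ((strictPast (fun k => m k ⊔ m' k) h.le).mono k.le_succ)
    rw [show e (k + 1) = _ from funext (h.step k)]
    exact ((he.sub ((h.stronglyMeasurable_apply (le_sup_left.trans hle) he).const_smul _)).add
      ((h.stronglyMeasurable_noise_sum hle).const_smul _)).sub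
      ((L.continuous.comp_stronglyMeasurable he).const_smul _)

lemma memLp_noise_smul (i : ι) (k : ℕ) : MemLp (fun ω => v i k ω • φ i k ω) 2 P := by
  refine (h.memLp_noise i k).of_le_mul (c := κ) ?_ (ae_of_all _ fun ω => ?_)
  · exact (h.memLp_noise i k).1.smul ((h.stronglyMeasurable_direction i k).mono
      (le_sup_left.trans (h.le k))).aestronglyMeasurable
  · rw [norm_smul, mul_comm]
    exact mul_le_mul_of_nonneg_right (h.norm_direction_le i k ω) (norm_nonneg _)

lemma memLp_apply {k : ℕ} (he : MemLp (e k) 2 P) : MemLp (fun ω => T k ω (e k ω)) 2 P :=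
  he.of_le_mul (isBoundedBilinearMap_apply.continuous.comp_aestronglyMeasurable
      (((h.stronglyMeasurable_operator k).mono
        (le_sup_left.trans (h.le k))).aestronglyMeasurable.prodMk he.1))
    (ae_of_all _ fun ω => (T k ω).le_of_opNorm_le (h.norm_operator_le k ω) _)

lemma memLp [IsFiniteMeasure P] (k : ℕ) : MemLp (e k) 2 P := by
  induction k with
  | zero =>
    obtain ⟨c, hc⟩ := h.init
    rw [show e 0 = fun _ => c from funext hc]
    exact memLp_const c
  | succ k ih =>
    rw [show e (k + 1) = _ from funext (h.step k)]
    exact ((ih.sub ((h.memLp_apply ih).const_smul _)).add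
      ((memLp_finsetSum _ fun i _ => h.memLp_noise_smul i k).const_smul _)).sub
      ((L.comp_memLp' ih).const_smul _)

lemma integrable_operator [IsFiniteMeasure P] (k : ℕ) : Integrable (T k) P :=
  Integrable.of_bound ((h.stronglyMeasurable_operator k).mono
    (le_sup_left.trans (h.le k))).aestronglyMeasurable R (ae_of_all _ (h.norm_operator_le k))

lemma condExp_noise_sum [CompleteSpace E] [IsFiniteMeasure P] (k : ℕ) :
    P[fun ω => ∑ i, v i k ω • φ i k ω | strictPast (fun k => m k ⊔ m' k) h.le k] =ᵐ[P] 0 := by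
  have hm := le_sup_left.trans (h.le k)
  have hsup := sup_le ((strictPast (fun k => m k ⊔ m' k) h.le).le k) hm
  have hint : ∀ i, Integrable (fun ω => v i k ω • φ i k ω) P := fun i =>
    (h.memLp_noise_smul i k).integrable one_le_two
  have hterm : ∀ i, P[fun ω => v i k ω • φ i k ω |
      strictPast (fun k => m k ⊔ m' k) h.le k ⊔ m k] =ᵐ[P] 0 := fun i =>
    condExp_smul_eq_zero_of_indep (le_sup_right.trans (h.le k)) hsup
      (indep_strictPast_sup_of_iIndep h.le h.iIndep k) (h.stronglyMeasurable_noise i k)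
      ((h.stronglyMeasurable_direction i k).mono le_sup_right)
      ((h.memLp_noise i k).integrable one_le_two) (hint i) (h.integral_noise i k)
  have hsum : P[fun ω => ∑ i, v i k ω • φ i k ω |
      strictPast (fun k => m k ⊔ m' k) h.le k ⊔ m k] =ᵐ[P] 0 := by
    have hfun : (fun ω => ∑ i, v i k ω • φ i k ω) = ∑ i, fun ω => v i k ω • φ i k ω := by
      ext ω; simp
    rw [hfun]
    filter_upwards [condExp_finsetSum (s := Finset.univ) (fun i _ => hint i)
      (strictPast (fun k => m k ⊔ m' k) h.le k ⊔ m k), ae_all_iff.2 hterm] with ω h1 h2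
    simp [h1, h2]
  calc P[fun ω => ∑ i, v i k ω • φ i k ω | strictPast (fun k => m k ⊔ m' k) h.le k]
      =ᵐ[P] P[P[fun ω => ∑ i, v i k ω • φ i k ω |
        strictPast (fun k => m k ⊔ m' k) h.le k ⊔ m k] |
        strictPast (fun k => m k ⊔ m' k) h.le k] :=
        (condExp_condExp_of_le le_sup_left hsup).symm
    _ =ᵐ[P] P[(0 : Ω → E) | strictPast (fun k => m k ⊔ m' k) h.le k] := condExp_congr_ae hsum
    _ = 0 := condExp_zero

lemma norm_integral_operator_le [IsProbabilityMeasure P] : ‖∫ ω, T 0 ω ∂P‖ ≤ R := by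
  simpa using norm_integral_le_of_norm_le_const (ae_of_all P (h.norm_operator_le 0))

lemma norm_operator_sub_le [IsProbabilityMeasure P] (k : ℕ) (ω : Ω) :
    ‖T k ω - ∫ ω', T 0 ω' ∂P‖ ≤ 2 * R := by
  linarith [norm_sub_le (T k ω) (∫ ω', T 0 ω' ∂P), h.norm_operator_le k ω,
    h.norm_integral_operator_le]

lemma norm_noise_sum_sq_le (k : ℕ) (ω : Ω) :
    ‖∑ i, v i k ω • φ i k ω‖ ^ 2 ≤ Fintype.card ι * ∑ i, κ ^ 2 * v i k ω ^ 2 := by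
  calc ‖∑ i, v i k ω • φ i k ω‖ ^ 2 ≤ (∑ i, ‖v i k ω • φ i k ω‖) ^ 2 := by
        gcongr; exact norm_sum_le _ _
    _ ≤ Fintype.card ι * ∑ i, ‖v i k ω • φ i k ω‖ ^ 2 := sq_sum_le_card_mul_sum_sq
    _ ≤ Fintype.card ι * ∑ i, κ ^ 2 * v i k ω ^ 2 := by
        gcongr with i
        rw [norm_smul, mul_pow, Real.norm_eq_abs, sq_abs, mul_comm]
        gcongr
        exact h.norm_direction_le i k ω

lemma integral_norm_noise_sum_sq_le (k : ℕ) :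
    ∫ ω, ‖∑ i, v i k ω • φ i k ω‖ ^ 2 ∂P ≤ (Fintype.card ι) ^ 2 * (κ ^ 2 * β) := by
  have hint : ∀ i ∈ Finset.univ, Integrable (fun ω => κ ^ 2 * v i k ω ^ 2) P := fun i _ =>
    (h.memLp_noise i k).integrable_sq.const_mul _
  calc ∫ ω, ‖∑ i, v i k ω • φ i k ω‖ ^ 2 ∂P
      ≤ ∫ ω, Fintype.card ι * ∑ i, κ ^ 2 * v i k ω ^ 2 ∂P :=
        integral_mono_of_nonneg (ae_of_all _ fun _ => by positivity)
          ((integrable_finsetSum _ hint).const_mul _) (ae_of_all _ (h.norm_noise_sum_sq_le k))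
    _ = Fintype.card ι * ∑ i, κ ^ 2 * ∫ ω, v i k ω ^ 2 ∂P := by
        rw [integral_const_mul, integral_finsetSum _ hint]
        simp_rw [integral_const_mul]
    _ ≤ Fintype.card ι * ∑ _i : ι, κ ^ 2 * β := by
        gcongr with i
        exact h.integral_noise_sq_le i k
    _ = (Fintype.card ι) ^ 2 * (κ ^ 2 * β) := by
        rw [Finset.sum_const, Finset.card_univ, nsmul_eq_mul]
        ring

theorem isStochasticApproximation [CompleteSpace E] [IsProbabilityMeasure P] (hβ : 0 ≤ β) :
    IsStochasticApproximation P (strictPast (fun k => m k ⊔ m' k) h.le) (∫ ω, T 0 ω ∂P + L) a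
      (fun k => |b k - a k| * ‖L‖) (2 * ((Fintype.card ι) ^ 2 * (κ ^ 2 * β)) + 2 * (2 * R) ^ 2) e
      (fun k ω => (a k - b k) • L (e k ω))
      (fun k ω => ∑ i, v i k ω • φ i k ω - (T k ω - ∫ ω', T 0 ω' ∂P) (e k ω)) where
  step k ω := by
    rw [h.step k ω]
    simp only [add_apply, sub_apply]
    module
  memLp := h.memLp
  stronglyMeasurable := h.stronglyMeasurable
  stronglyMeasurable_perturbation k :=
    (L.continuous.comp_stronglyMeasurable (h.stronglyMeasurable k)).const_smul _
  norm_perturbation_le k ω := by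
    rw [norm_smul, Real.norm_eq_abs, abs_sub_comm, mul_assoc]
    exact mul_le_mul_of_nonneg_left (L.le_opNorm _) (abs_nonneg _)
  memLp_noise k := by
    simp only [sub_apply]
    exact (memLp_finsetSum _ fun i _ => h.memLp_noise_smul i k).sub
      ((h.memLp_apply (h.memLp k)).sub ((∫ ω, T 0 ω ∂P).comp_memLp' (h.memLp k)))
  stronglyMeasurable_noise k := by
    have hle := le_strictPast h.le k.lt_succ_self
    have he := (h.stronglyMeasurable k).mono
      ((strictPast (fun k => m k ⊔ m' k) h.le).mono k.le_succ)
    simp only [sub_apply]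
    exact (h.stronglyMeasurable_noise_sum hle).sub
      ((h.stronglyMeasurable_apply (le_sup_left.trans hle) he).sub
        ((∫ ω, T 0 ω ∂P).continuous.comp_stronglyMeasurable he))
  condExp_noise k := by
    have hint := (h.memLp_apply (h.memLp k)).sub ((∫ ω, T 0 ω ∂P).comp_memLp' (h.memLp k))
    have hop := condExp_clm_apply_of_indep (T := fun ω => T k ω - ∫ ω', T 0 ω' ∂P)
      (le_sup_left.trans (h.le k)) ((strictPast (fun k => m k ⊔ m' k) h.le).le k)
      (indep_strictPast_of_iIndep h.le h.iIndep k)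
      ((h.stronglyMeasurable_operator k).sub stronglyMeasurable_const) (h.stronglyMeasurable k)
      ((h.integrable_operator k).sub (integrable_const _)) (hint.integrable one_le_two)
    filter_upwards [condExp_sub ((memLp_finsetSum Finset.univ
        fun i _ => h.memLp_noise_smul i k).integrable one_le_two) (hint.integrable one_le_two)
        (strictPast (fun k => m k ⊔ m' k) h.le k), hop, h.condExp_noise_sum k] with ω h1 h2 h3
    refine h1.trans ?_
    rw [Pi.sub_apply, h3]
    refine (congrArg _ h2).trans ?_
    rw [integral_sub (h.integrable_operator k) (integrable_const _), h.integral_operator k]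
    simp
  integral_norm_noise_sq_le k := by
    have hs : Integrable (fun ω => ‖∑ i, v i k ω • φ i k ω‖ ^ 2) P :=
      (memLp_finsetSum Finset.univ fun i _ => h.memLp_noise_smul i k).integrable_norm_pow
        two_ne_zero
    have he : Integrable (fun ω => ‖e k ω‖ ^ 2) P := (h.memLp k).integrable_norm_pow two_ne_zero
    have he0 : 0 ≤ ∫ ω, ‖e k ω‖ ^ 2 ∂P := integral_nonneg fun _ => sq_nonneg _
    calc ∫ ω, ‖∑ i, v i k ω • φ i k ω - (T k ω - ∫ ω', T 0 ω' ∂P) (e k ω)‖ ^ 2 ∂P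
        ≤ ∫ ω, 2 * ‖∑ i, v i k ω • φ i k ω‖ ^ 2 + 2 * (2 * R) ^ 2 * ‖e k ω‖ ^ 2 ∂P := by
          refine integral_mono_of_nonneg (ae_of_all _ fun _ => sq_nonneg _)
            ((hs.const_mul _).add (he.const_mul _)) (ae_of_all _ fun ω => ?_)
          have h1 := (T k ω - ∫ ω', T 0 ω' ∂P).le_of_opNorm_le (h.norm_operator_sub_le k ω) (e k ω)
          have h2 := norm_sub_le (∑ i, v i k ω • φ i k ω) ((T k ω - ∫ ω', T 0 ω' ∂P) (e k ω))
          calc ‖∑ i, v i k ω • φ i k ω - (T k ω - ∫ ω', T 0 ω' ∂P) (e k ω)‖ ^ 2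
              ≤ (‖∑ i, v i k ω • φ i k ω‖ + 2 * R * ‖e k ω‖) ^ 2 := by
                gcongr
                linarith
            _ ≤ 2 * ‖∑ i, v i k ω • φ i k ω‖ ^ 2 + 2 * (2 * R) ^ 2 * ‖e k ω‖ ^ 2 := by
                linarith [add_sq_le (a := ‖∑ i, v i k ω • φ i k ω‖) (b := 2 * R * ‖e k ω‖)]
      _ = 2 * ∫ ω, ‖∑ i, v i k ω • φ i k ω‖ ^ 2 ∂P + 2 * (2 * R) ^ 2 * ∫ ω, ‖e k ω‖ ^ 2 ∂P := by
          rw [integral_add (hs.const_mul _) (he.const_mul _), integral_const_mul,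
            integral_const_mul]
      _ ≤ (2 * ((Fintype.card ι) ^ 2 * (κ ^ 2 * β)) + 2 * (2 * R) ^ 2)
          * (1 + ∫ ω, ‖e k ω‖ ^ 2 ∂P) := by
          have hc : 0 ≤ ((Fintype.card ι) ^ 2 * (κ ^ 2 * β) : ℝ) := by positivity
          nlinarith [h.integral_norm_noise_sum_sq_le k, mul_nonneg hc he0, sq_nonneg (2 * R)]

end IsRandomLinearRecursion

end RandomLinearRecursion

section NetworkOperators

variable {ι H : Type*} [Fintype ι] [NormedAddCommGroup H] [InnerProductSpace ℝ H]

/-- The Hilbert sum `⨁ i, H` of copies of `H` indexed by the nodes `i : ι` of a network. -/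
def NetworkSpace (ι H : Type*) : Type _ := PiLp 2 fun _ : ι => H

namespace NetworkSpace

instance : NormedAddCommGroup (NetworkSpace ι H) :=
  inferInstanceAs (NormedAddCommGroup (PiLp 2 fun _ : ι => H))

instance : InnerProductSpace ℝ (NetworkSpace ι H) :=
  inferInstanceAs (InnerProductSpace ℝ (PiLp 2 fun _ : ι => H))

instance [CompleteSpace H] : CompleteSpace (NetworkSpace ι H) :=
  inferInstanceAs (CompleteSpace (PiLp 2 fun _ : ι => H))

/-- The element of `NetworkSpace ι H` with given coordinates. -/
def mk (x : ι → H) : NetworkSpace ι H := WithLp.toLp 2 x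

/-- The coordinate of an element of `NetworkSpace ι H` at the node `i`. -/
def coord (i : ι) : NetworkSpace ι H →L[ℝ] H := PiLp.proj 2 (fun _ : ι => H) i

lemma coord_mk (x : ι → H) (i : ι) : coord i (mk x) = x i := rfl

@[ext]
lemma ext {e e' : NetworkSpace ι H} (h : ∀ i, coord i e = coord i e') : e = e' := PiLp.ext h

lemma inner_eq_sum (e e' : NetworkSpace ι H) : ⟪e, e'⟫ = ∑ i, ⟪coord i e, coord i e'⟫ := rfl

lemma norm_coord_le (e : NetworkSpace ι H) (i : ι) : ‖coord i e‖ ≤ ‖e‖ :=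
  PiLp.norm_apply_le (show PiLp 2 fun _ : ι => H from e) i

variable [DecidableEq ι]

/-- The inclusion of `H` in `NetworkSpace ι H` as the summand of the node `i`. -/
def single (i : ι) : H →L[ℝ] NetworkSpace ι H :=
  (PiLp.continuousLinearEquiv 2 ℝ fun _ : ι => H).symm.toContinuousLinearMap ∘L
    ContinuousLinearMap.single ℝ (fun _ => H) i

lemma coord_single (i j : ι) (x : H) : coord i (single j x) = if i = j then x else 0 :=
  Pi.single_apply j x i

lemma norm_single (i : ι) (x : H) : ‖single i x‖ = ‖x‖ :=
  PiLp.norm_single 2 (fun _ : ι => H) i x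

lemma coord_sum_single (x : ι → H) (i : ι) : coord i (∑ j, single j (x j)) = x i := by
  simp [map_sum, coord_single]

lemma inner_single (i : ι) (x : H) (e : NetworkSpace ι H) : ⟪single i x, e⟫ = ⟪x, coord i e⟫ := by
  rw [inner_eq_sum, Finset.sum_eq_single i _ (by simp)]
  · simp [coord_single]
  · intro j _ hj
    simp [coord_single, hj]

lemma inner_sum_single (x : ι → H) (e : NetworkSpace ι H) :
    ⟪∑ j, single j (x j), e⟫ = ∑ i, ⟪x i, coord i e⟫ := by
  simp_rw [sum_inner, inner_single]

end NetworkSpace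

open NetworkSpace

variable [DecidableEq ι]

/-- The block diagonal operator `diag (x₁ ⊗ x₁, …, x_N ⊗ x_N)`. -/
def samplingOperator (x : ι → H) : NetworkSpace ι H →L[ℝ] NetworkSpace ι H :=
  ∑ i, InnerProductSpace.rankOne ℝ (single i (x i)) (single i (x i))

lemma samplingOperator_eq_sum (x : ι → H) (e : NetworkSpace ι H) :
    samplingOperator x e = ∑ i, single i (⟪x i, coord i e⟫ • x i) := by
  simp [samplingOperator, inner_single]

lemma samplingOperator_apply (x : ι → H) (e : NetworkSpace ι H) (i : ι) :
    coord i (samplingOperator x e) = ⟪x i, coord i e⟫ • x i := by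
  rw [samplingOperator_eq_sum, coord_sum_single]

lemma inner_samplingOperator (x : ι → H) (e e' : NetworkSpace ι H) :
    ⟪samplingOperator x e, e'⟫ = ∑ i, ⟪x i, coord i e⟫ * ⟪x i, coord i e'⟫ := by
  simp_rw [samplingOperator_eq_sum, inner_sum_single, real_inner_smul_left]

lemma norm_samplingOperator_le {κ : ℝ} {x : ι → H} (hx : ∀ i, ‖x i‖ ≤ κ) :
    ‖samplingOperator x‖ ≤ Fintype.card ι * κ ^ 2 := by
  calc ‖samplingOperator x‖ ≤ ∑ i, ‖InnerProductSpace.rankOne ℝ (single i (x i))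
        (single i (x i))‖ := norm_sum_le _ _
    _ ≤ ∑ _i : ι, κ ^ 2 := by
        gcongr with i
        rw [InnerProductSpace.norm_rankOne, norm_single, ← sq]
        exact pow_le_pow_left₀ (norm_nonneg _) (hx i) 2
    _ = Fintype.card ι * κ ^ 2 := by simp

lemma continuous_samplingOperator :
    Continuous (samplingOperator : (ι → H) → NetworkSpace ι H →L[ℝ] NetworkSpace ι H) := by
  refine continuous_finsetSum _ fun i _ => ?_
  have hi : Continuous fun x : ι → H => (single i (x i) : NetworkSpace ι H) :=
    (single i : H →L[ℝ] NetworkSpace ι H).continuous.comp (continuous_apply i)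
  exact ((InnerProductSpace.rankOne ℝ).continuous.comp hi).clm_apply hi

/-- The Laplacian of the weighted graph with adjacency matrix `A`, acting on `⨁ j, H`. -/
def networkLaplacian (A : ι → ι → ℝ) : NetworkSpace ι H →L[ℝ] NetworkSpace ι H :=
  ∑ i, single i ∘L ∑ j, A i j • (coord i - coord j : NetworkSpace ι H →L[ℝ] H)

variable {A : ι → ι → ℝ}

lemma networkLaplacian_eq_sum (e : NetworkSpace ι H) :
    networkLaplacian A e = ∑ i, single i (∑ j, A i j • (coord i e - coord j e)) := by
  simp [networkLaplacian]

lemma networkLaplacian_apply (e : NetworkSpace ι H) (i : ι) :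
    coord i (networkLaplacian A e) = ∑ j, A i j • (coord i e - coord j e) := by
  rw [networkLaplacian_eq_sum, coord_sum_single]

lemma inner_networkLaplacian (hA : ∀ i j, A i j = A j i) (e e' : NetworkSpace ι H) :
    ⟪networkLaplacian A e, e'⟫
      = (∑ i, ∑ j, A i j * ⟪coord i e - coord j e, coord i e' - coord j e'⟫) / 2 := by
  have h1 : ⟪networkLaplacian A e, e'⟫
      = ∑ i, ∑ j, A i j * ⟪coord i e - coord j e, coord i e'⟫ := by
    simp_rw [networkLaplacian_eq_sum, inner_sum_single, sum_inner, real_inner_smul_left]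
  have h2 : ⟪networkLaplacian A e, e'⟫
      = ∑ i, ∑ j, A i j * ⟪coord j e - coord i e, coord j e'⟫ := by
    rw [h1, Finset.sum_comm]
    simp_rw [hA]
  have h3 : ∑ i, ∑ j, A i j * ⟪coord i e - coord j e, coord i e' - coord j e'⟫
      = ∑ i, ∑ j, A i j * ⟪coord i e - coord j e, coord i e'⟫
        + ∑ i, ∑ j, A i j * ⟪coord j e - coord i e, coord j e'⟫ := by
    simp_rw [← Finset.sum_add_distrib]
    refine Finset.sum_congr rfl fun i _ => Finset.sum_congr rfl fun j _ => ?_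
    rw [← mul_add, inner_sub_right, ← neg_sub (coord i e) (coord j e), inner_neg_left,
      sub_eq_add_neg]
  rw [h3, ← h1, ← h2]
  ring

lemma inner_networkLaplacian_symm (hA : ∀ i j, A i j = A j i) (e e' : NetworkSpace ι H) :
    ⟪networkLaplacian A e, e'⟫ = ⟪e, networkLaplacian A e'⟫ := by
  rw [real_inner_comm _ e, inner_networkLaplacian hA, inner_networkLaplacian hA]
  simp_rw [real_inner_comm]

lemma inner_networkLaplacian_self_nonneg (hA : ∀ i j, A i j = A j i) (hA0 : ∀ i j, 0 ≤ A i j)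
    (e : NetworkSpace ι H) : 0 ≤ ⟪networkLaplacian A e, e⟫ := by
  rw [inner_networkLaplacian hA]
  exact div_nonneg (Finset.sum_nonneg fun i _ => Finset.sum_nonneg fun j _ =>
    mul_nonneg (hA0 i j) real_inner_self_nonneg) zero_le_two

lemma coord_eq_coord_of_inner_networkLaplacian_eq_zero (hA : ∀ i j, A i j = A j i)
    (hA0 : ∀ i j, 0 ≤ A i j)
    (hconn : ∀ i j, Relation.ReflTransGen (fun p q => 0 < A p q) i j)
    {e : NetworkSpace ι H} (he : ⟪networkLaplacian A e, e⟫ = 0) (i j : ι) :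
    coord i e = coord j e := by
  have hnn : ∀ p q, 0 ≤ A p q * ⟪coord p e - coord q e, coord p e - coord q e⟫ := fun p q =>
    mul_nonneg (hA0 p q) real_inner_self_nonneg
  rw [inner_networkLaplacian hA, _root_.div_eq_zero_iff, or_iff_left two_ne_zero,
    Finset.sum_eq_zero_iff_of_nonneg fun p _ => Finset.sum_nonneg fun q _ => hnn p q] at he
  have hadj : ∀ p q, 0 < A p q → coord p e = coord q e := fun p q hpq => by
    have := (Finset.sum_eq_zero_iff_of_nonneg fun q _ => hnn p q).1 (he p (Finset.mem_univ p)) q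
      (Finset.mem_univ q)
    rw [mul_eq_zero, or_iff_right hpq.ne', inner_self_eq_zero, sub_eq_zero] at this
    exact this
  induction hconn i j with
  | refl => rfl
  | tail _ hpq ih => exact ih.trans (hadj _ _ hpq)

lemma inner_add_networkLaplacian_pos [Nonempty ι] (hA : ∀ i j, A i j = A j i)
    (hA0 : ∀ i j, 0 ≤ A i j)
    (hconn : ∀ i j, Relation.ReflTransGen (fun p q => 0 < A p q) i j)
    {T : NetworkSpace ι H →L[ℝ] NetworkSpace ι H} (hT : ∀ e, 0 ≤ ⟪T e, e⟫)
    (hT_consensus : ∀ g : H, g ≠ 0 →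
      0 < ⟪T (mk fun _ => g), mk fun _ => g⟫)
    {e : NetworkSpace ι H} (he : e ≠ 0) :
    0 < ⟪(T + networkLaplacian A : NetworkSpace ι H →L[ℝ] NetworkSpace ι H) e, e⟫ := by
  rw [add_apply, inner_add_left]
  rcases (inner_networkLaplacian_self_nonneg hA hA0 e).lt_or_eq with hpos | hzero
  · exact add_pos_of_nonneg_of_pos (hT e) hpos
  · obtain ⟨i₀⟩ := ‹Nonempty ι›
    have hconst : e = mk fun _ => coord i₀ e := NetworkSpace.ext fun i =>
        coord_eq_coord_of_inner_networkLaplacian_eq_zero hA hA0 hconn hzero.symm i i₀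
    have hg : coord i₀ e ≠ 0 := fun h0 => he <| NetworkSpace.ext fun i => by
      rw [hconst, coord_mk, h0, map_zero]
    rw [← hzero, add_zero, hconst]
    exact hT_consensus _ hg

section Expectation

variable {Ω : Type*} {mΩ : MeasurableSpace Ω} {P : Measure Ω} [CompleteSpace H] {X : Ω → ι → H}

lemma inner_integral_samplingOperator (hX : Integrable (fun ω => samplingOperator (X ω)) P)
    (e e' : NetworkSpace ι H) :
    ⟪(∫ ω, samplingOperator (X ω) ∂P) e, e'⟫
      = ∫ ω, ∑ i, ⟪X ω i, coord i e⟫ * ⟪X ω i, coord i e'⟫ ∂P := by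
  rw [ContinuousLinearMap.integral_apply hX, real_inner_comm,
    ← integral_inner (hX.apply_continuousLinearMap e)]
  refine integral_congr_ae (ae_of_all _ fun ω => ?_)
  exact (real_inner_comm _ _).trans (inner_samplingOperator _ _ _)

lemma inner_integral_samplingOperator_symm
    (hX : Integrable (fun ω => samplingOperator (X ω)) P) (e e' : NetworkSpace ι H) :
    ⟪(∫ ω, samplingOperator (X ω) ∂P) e, e'⟫ = ⟪e, (∫ ω, samplingOperator (X ω) ∂P) e'⟫ := by
  rw [real_inner_comm _ e, inner_integral_samplingOperator hX, inner_integral_samplingOperator hX]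
  simp_rw [mul_comm]

lemma inner_integral_samplingOperator_self_nonneg
    (hX : Integrable (fun ω => samplingOperator (X ω)) P) (e : NetworkSpace ι H) :
    0 ≤ ⟪(∫ ω, samplingOperator (X ω) ∂P) e, e⟫ := by
  rw [inner_integral_samplingOperator hX]
  exact integral_nonneg fun ω => Finset.sum_nonneg fun i _ => mul_self_nonneg _

lemma inner_integral_samplingOperator_const
    (hX : Integrable (fun ω => samplingOperator (X ω)) P)
    (hX' : Integrable (fun ω => ∑ i, rankOne (X ω i) (X ω i)) P) (g : H) :
    ⟪(∫ ω, samplingOperator (X ω) ∂P) (mk fun _ => g), mk fun _ => g⟫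
      = ⟪(∫ ω, ∑ i, rankOne (X ω i) (X ω i) ∂P) g, g⟫ := by
  rw [inner_integral_samplingOperator hX, ContinuousLinearMap.integral_apply hX',
    real_inner_comm, ← integral_inner (hX'.apply_continuousLinearMap g)]
  refine integral_congr_ae (ae_of_all _ fun ω => ?_)
  simp [rankOne, inner_sum, real_inner_smul_right, real_inner_comm, coord_mk]

end Expectation

end NetworkOperators

section Data

variable {Ω S H ι : Type*} {mΩ : MeasurableSpace Ω} {P : Measure Ω}
  [NormedAddCommGroup H] [InnerProductSpace ℝ H]

lemma continuous_of_continuous_inner [TopologicalSpace S] {φ : S → H}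
    (hφ : Continuous fun p : S × S => ⟪φ p.1, φ p.2⟫) : Continuous φ := by
  refine continuous_iff_continuousAt.2 fun x => tendsto_iff_norm_sub_tendsto_zero.2 ?_
  have hsq : Continuous fun y => √(⟪φ y, φ y⟫ - 2 * ⟪φ y, φ x⟫ + ⟪φ x, φ x⟫) :=
    (((hφ.comp (continuous_id.prodMk continuous_id)).sub
      ((hφ.comp (continuous_id.prodMk continuous_const)).const_mul 2)).add
        continuous_const).sqrt
  have hnorm : ∀ y, ‖φ y - φ x‖ = √(⟪φ y, φ y⟫ - 2 * ⟪φ y, φ x⟫ + ⟪φ x, φ x⟫) := fun y => by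
    rw [real_inner_self_eq_norm_sq, real_inner_self_eq_norm_sq, ← norm_sub_sq_real,
      Real.sqrt_sq (norm_nonneg _)]
  simp_rw [hnorm]
  convert! hsq.tendsto x using 2
  rw [← hnorm, sub_self, norm_zero]

lemma comap_pi_le {X : ι → Type*} [∀ i, MeasurableSpace (X i)] {x : ∀ i, Ω → X i}
    {m₀ : MeasurableSpace Ω} (h : ∀ i, MeasurableSpace.comap (x i) inferInstance ≤ m₀) :
    MeasurableSpace.comap (fun ω i => x i ω) inferInstance ≤ m₀ :=
  (measurable_pi_iff.2 fun i => Measurable.of_comap_le (h i)).comap_le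

lemma comap_coe_eq {F : Type*} [MeasurableSpace F] {S : Set F} (x : Ω → S) :
    MeasurableSpace.comap (fun ω => (x ω : F)) inferInstance
      = MeasurableSpace.comap x inferInstance :=
  MeasurableSpace.comap_comp.symm

lemma rkhsFilt_le {N : ℕ} {Kx : S → H} {xi : Fin N → ℕ → Ω → S} {v : Fin N → ℕ → Ω → ℝ}
    (hx : ∀ i k g, Measurable fun ω => ⟪g, Kx (xi i k ω)⟫) (hv : ∀ i k, Measurable (v i k))
    (k : ℕ) : rkhsFilt Kx xi v k ≤ mΩ :=
  iSup₂_le fun s _ => iSup_le fun i =>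
    sup_le (iSup_le fun g => (hx i s g).comap_le) (hv i s).comap_le

lemma integral_eq_zero_of_condExp_eq_zero [IsFiniteMeasure P] {m : MeasurableSpace Ω}
    (hm : m ≤ mΩ) {u : Ω → ℝ} (hu : P[u | m] =ᵐ[P] 0) : ∫ ω, u ω ∂P = 0 := by
  rw [← integral_condExp hm, integral_congr_ae hu]
  simp

lemma integral_le_of_condExp_le [IsProbabilityMeasure P] {m : MeasurableSpace Ω}
    (hm : m ≤ mΩ) {u : Ω → ℝ} {β : ℝ} (hu : P[u | m] ≤ᵐ[P] fun _ => β) : ∫ ω, u ω ∂P ≤ β := by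
  rw [← integral_condExp hm]
  simpa using integral_mono_ae integrable_condExp (integrable_const β) hu

lemma integral_comp_eq_of_map_eq {F : Type*} [NormedAddCommGroup F] [NormedSpace ℝ F]
    [MeasurableSpace S] {G : S → F} (hG : StronglyMeasurable G) {X Y : Ω → S}
    (hX : Measurable X) (hY : Measurable Y) (hXY : P.map X = P.map Y) :
    ∫ ω, G (X ω) ∂P = ∫ ω, G (Y ω) ∂P := by
  rw [← integral_map hX.aemeasurable hG.aestronglyMeasurable, hXY,
    integral_map hY.aemeasurable hG.aestronglyMeasurable]

lemma summable_abs_sub_of_le {a b : ℕ → ℝ} {C : ℝ} (ha : Summable fun k => a k ^ 2)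
    (hb : Summable fun k => b k ^ 2) (h : ∀ k, |b k - a k| ≤ C * (a k ^ 2 + b k ^ 2)) :
    Summable fun k => |b k - a k| :=
  .of_nonneg_of_le (fun _ => abs_nonneg _) h ((ha.add hb).mul_left C)

end Data

section Consistency

variable {Ω H : Type*} {mΩ : MeasurableSpace Ω} {P : Measure Ω}
  [NormedAddCommGroup H] {g : ℕ → Ω → H} {r : ℕ → Ω → ℝ}

lemma tendsto_lintegral_nnnorm_sq (hr : ∀ k, Integrable (fun ω => r k ω ^ 2) P)
    (hgr : ∀ k ω, ‖g k ω‖ ≤ r k ω)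
    (h : Tendsto (fun k => ∫ ω, r k ω ^ 2 ∂P) atTop (nhds 0)) :
    Tendsto (fun k => ∫⁻ ω, (‖g k ω‖₊ : ℝ≥0∞) ^ 2 ∂P) atTop (nhds 0) := by
  have hlim : Tendsto (fun k => ENNReal.ofReal (∫ ω, r k ω ^ 2 ∂P)) atTop (nhds 0) := by
    simpa using ENNReal.tendsto_ofReal h
  refine tendsto_of_tendsto_of_tendsto_of_le_of_le tendsto_const_nhds hlim
    (fun _ => zero_le) fun k => ?_
  rw [ofReal_integral_eq_lintegral_ofReal (hr k) (ae_of_all _ fun ω => sq_nonneg _)]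
  refine lintegral_mono fun ω => ?_
  rw [← enorm_eq_nnnorm, ← ofReal_norm, ← ENNReal.ofReal_pow (norm_nonneg _)]
  exact ENNReal.ofReal_le_ofReal (pow_le_pow_left₀ (norm_nonneg _) (hgr k ω) 2)

end Consistency

/-- Corollary 3. For the decentralized online learning algorithm in the RKHS
`H_K`, suppose `𝒢` is connected, Assumptions A3–A5 and Conditions C1–C3 hold, and the sequences
`{(x₁(k),…,x_N(k))}` and `{(v₁(k),…,v_N(k))}` are both i.i.d. and mutually independent. If the
covariance-type operator `E[∑ⱼ K_{xⱼ(0)} ⊗ K_{xⱼ(0)}]` is strictly positive, then the algorithm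
is both mean square consistent and almost surely strongly consistent. -/
theorem decentralized_online_learning.stmt8
    {Ω : Type*} [MeasurableSpace Ω] (P : Measure Ω) [IsProbabilityMeasure P]
    -- the input space 𝒳 ⊆ ℝⁿ and the Mercer kernel K
    {n : ℕ} (S : Set (EuclideanSpace ℝ (Fin n))) (hS : S.Nonempty)
    (K : EuclideanSpace ℝ (Fin n) → EuclideanSpace ℝ (Fin n) → ℝ)
    (hK_cont : ContinuousOn
      (fun p : EuclideanSpace ℝ (Fin n) × EuclideanSpace ℝ (Fin n) => K p.1 p.2) (S ×ˢ S))
    (hK_symm : ∀ x ∈ S, ∀ y ∈ S, K x y = K y x)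
    -- the reproducing kernel Hilbert space H_K with kernel sections K_x, x ∈ 𝒳;
    -- the value of f ∈ H_K at x ∈ 𝒳 is f(x) = ⟪f, K_x⟫
    {HK : Type*} [NormedAddCommGroup HK] [InnerProductSpace ℝ HK] [CompleteSpace HK]
    (Kx : S → HK)
    (hKer : ∀ x y : S, ⟪Kx x, Kx y⟫ = K x y)
    -- the weighted adjacency matrix of the graph 𝒢
    {N : ℕ} (hN : 0 < N)
    (A : Fin N → Fin N → ℝ)
    (hA_symm : ∀ i j, A i j = A j i) (hA_nonneg : ∀ i j, 0 ≤ A i j) (hA_diag : ∀ i, A i i = 0)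
    -- the graph 𝒢 is connected
    (hconn : ∀ i j : Fin N, Relation.ReflTransGen (fun p q : Fin N => 0 < A p q) i j)
    -- random input data, noises and the unknown function f₀
    (xi : Fin N → ℕ → Ω → S)
    (hxi_meas : ∀ i k, Measurable (fun ω => (xi i k ω : EuclideanSpace ℝ (Fin n))))
    (v : Fin N → ℕ → Ω → ℝ)
    (hv_meas : ∀ i k, Measurable (v i k))
    (f₀ : HK)
    -- gains
    (a b : ℕ → ℝ) (ha_pos : ∀ k, 0 < a k) (hb_pos : ∀ k, 0 < b k)
    -- Assumption A3: the inputs are independent of the noises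
    (hA3 : Indep
        (⨆ (i : Fin N) (k : ℕ), MeasurableSpace.comap
          (fun ω => (xi i k ω : EuclideanSpace ℝ (Fin n))) inferInstance)
        (⨆ (i : Fin N) (k : ℕ), MeasurableSpace.comap (v i k) (borel ℝ)) P)
    -- Assumption A4: martingale difference noises with bounded conditional second moments
    (hA4_int : ∀ i k, Integrable (v i k) P)
    (hA4_mds : ∀ i k, P[v i k | rkhsFilt Kx xi v k] =ᵐ[P] 0)
    (hA4_int2 : ∀ i k, Integrable (fun ω => (v i k ω) ^ 2) P)
    (β : ℝ) (hβ : 0 < β)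
    (hA4_bdd : ∀ i k, P[fun ω => (v i k ω) ^ 2 | rkhsFilt Kx xi v k] ≤ᵐ[P] fun _ => β)
    -- Assumption A5: bounded kernel
    (hA5 : ∃ κ : ℝ, ∀ x : S, K x x ≤ κ)
    -- Conditions C1, C2, C3
    (hC1a : Antitone a) (hC1b : Antitone b)
    (hC2a : Summable (fun k => a k ^ 2)) (hC2b : Summable (fun k => b k ^ 2))
    (hC3a : ¬ Summable a)
    (hC3b : ∃ C > (0 : ℝ), ∀ k, max (a k - a (k + 1)) |b k - a k| ≤ C * (a k ^ 2 + b k ^ 2))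
    -- the decentralized online learning algorithm with deterministic initial values
    (f : Fin N → ℕ → Ω → HK)
    (hf_init : ∀ i, ∃ c : HK, ∀ ω, f i 0 ω = c)
    (hAlg : ∀ i k ω, f i (k + 1) ω = f i k ω
        + (a k * ((⟪f₀, Kx (xi i k ω)⟫ + v i k ω) - ⟪f i k ω, Kx (xi i k ω)⟫)) • Kx (xi i k ω)
        + b k • ∑ j, A i j • (f j k ω - f i k ω))
    -- {(x₁(k),…,x_N(k))} is an i.i.d. sequence
    (hx_iid_indep : iIndep (fun k => MeasurableSpace.comap
        (fun ω (i : Fin N) => xi i k ω) inferInstance) P)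
    (hx_iid_ident : ∀ k,
        Measure.map (fun ω (i : Fin N) => xi i k ω) P
          = Measure.map (fun ω (i : Fin N) => xi i 0 ω) P)
    -- {(v₁(k),…,v_N(k))} is an i.i.d. sequence
    (hv_iid_indep : iIndep (fun k => MeasurableSpace.comap
        (fun ω (i : Fin N) => v i k ω) inferInstance) P)
    (hv_iid_ident : ∀ k,
        Measure.map (fun ω (i : Fin N) => v i k ω) P
          = Measure.map (fun ω (i : Fin N) => v i 0 ω) P)
    -- the expected covariance-type operator is strictly positive
    (hKK_int : Integrable (fun ω => ∑ j, rankOne (Kx (xi j 0 ω)) (Kx (xi j 0 ω))) P)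
    (hcov_pos : ∀ g : HK, g ≠ 0 →
        0 < ⟪(∫ ω, (∑ j, rankOne (Kx (xi j 0 ω)) (Kx (xi j 0 ω))) ∂P) g, g⟫) :
    -- mean square and almost sure strong consistency
    (∀ i, Tendsto (fun k => ∫⁻ ω, (‖f i k ω - f₀‖₊ : ℝ≥0∞) ^ 2 ∂P) atTop (nhds 0)) ∧
      (∀ i, ∀ᵐ ω ∂P, Tendsto (fun k => ‖f i k ω - f₀‖) atTop (nhds 0)) := by
  obtain ⟨κ, hκ⟩ := hA5
  obtain ⟨C, -, hC⟩ := hC3b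
  choose c hc using hf_init
  have : Nonempty (Fin N) := ⟨⟨0, hN⟩⟩
  have hKx : Continuous Kx := continuous_of_continuous_inner <| by
    simp_rw [hKer]
    have hcoe : Continuous fun p : S × S =>
      ((p.1 : EuclideanSpace ℝ (Fin n)), (p.2 : EuclideanSpace ℝ (Fin n))) := by fun_prop
    exact hK_cont.comp_continuous hcoe fun p => ⟨p.1.2, p.2.2⟩
  have hKx_norm : ∀ x, ‖Kx x‖ ≤ √κ := fun x => Real.le_sqrt_of_sq_le <| by
    rw [← real_inner_self_eq_norm_sq, hKer]
    exact hκ x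
  have hxi : ∀ i k, Measurable (xi i k) := fun i k => (hxi_meas i k).subtype_mk
  have hX : ∀ k, Measurable fun ω i => xi i k ω := fun k => measurable_pi_iff.2 fun i => hxi i k
  have hfilt := rkhsFilt_le (Kx := Kx)
    (fun i k g => ((continuous_const.inner hKx).measurable (γ := ℝ)).comp (hxi i k)) hv_meas
  let T : ℕ → Ω → NetworkSpace (Fin N) HK →L[ℝ] NetworkSpace (Fin N) HK := fun k ω =>
    samplingOperator fun i => Kx (xi i k ω)
  let e : ℕ → Ω → NetworkSpace (Fin N) HK := fun k ω => NetworkSpace.mk fun i => f i k ω - f₀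
  have hop : StronglyMeasurable fun x : Fin N → S =>
      (samplingOperator fun i => Kx (x i) : NetworkSpace (Fin N) HK →L[ℝ] _) :=
    (continuous_samplingOperator.comp
      (continuous_pi fun i => hKx.comp (continuous_apply i))).stronglyMeasurable
  have hrec : IsRandomLinearRecursion P
      (fun k => MeasurableSpace.comap (fun ω (i : Fin N) => xi i k ω) inferInstance)
      (fun k => MeasurableSpace.comap (fun ω (i : Fin N) => v i k ω) inferInstance)
      (networkLaplacian A) a b (Fintype.card (Fin N) * √κ ^ 2) √κ β T
      (fun i k ω => NetworkSpace.single i (Kx (xi i k ω))) v e :=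
    { le := fun k => sup_le (hX k).comap_le (measurable_pi_iff.2 fun i => hv_meas i k).comap_le
      iIndep := iIndep_sumElim hx_iid_indep hv_iid_indep <| indep_of_indep_of_le_right
        (indep_of_indep_of_le_left hA3 <| iSup_le fun k => comap_pi_le fun i => by
          rw [← comap_coe_eq]
          exact le_iSup₂_of_le i k le_rfl)
        (iSup_le fun k => comap_pi_le fun i => le_iSup₂_of_le i k le_rfl)
      init := ⟨NetworkSpace.mk fun i => c i - f₀, fun ω => by simp only [e, hc]⟩
      step := fun k ω => by
        have hnoise : ∑ i, v i k ω • NetworkSpace.single i (Kx (xi i k ω))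
            = ∑ i, NetworkSpace.single i (v i k ω • Kx (xi i k ω)) :=
          Finset.sum_congr rfl fun i _ => (map_smul _ _ _).symm
        ext i
        rw [hnoise, map_sub, map_add, map_sub, map_smul, map_smul, map_smul,
          NetworkSpace.coord_sum_single, samplingOperator_apply, networkLaplacian_apply]
        simp only [e, NetworkSpace.coord_mk, hAlg, sub_sub_sub_cancel_right]
        simp_rw [← neg_sub (f i k ω) (f _ k ω), smul_neg, Finset.sum_neg_distrib]
        rw [inner_sub_right, real_inner_comm _ f₀, real_inner_comm _ (f i k ω)]
        module
      stronglyMeasurable_operator := fun k => hop.comp_measurable (comap_measurable _)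
      norm_operator_le := fun k ω => norm_samplingOperator_le fun i => hKx_norm _
      integral_operator := fun k =>
        integral_comp_eq_of_map_eq hop (hX k) (hX 0) (hx_iid_ident k)
      stronglyMeasurable_direction := fun i k =>
        (((NetworkSpace.single i : HK →L[ℝ] NetworkSpace (Fin N) HK).continuous.comp
          (hKx.comp (continuous_apply (A := fun _ => S) i))).stronglyMeasurable).comp_measurable
            (comap_measurable fun ω i => xi i k ω)
      norm_direction_le := fun i k ω => by
        rw [NetworkSpace.norm_single]
        exact hKx_norm _
      stronglyMeasurable_noise := fun i k =>
        (measurable_pi_apply i).comp (comap_measurable fun ω i => v i k ω) |>.stronglyMeasurable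
      memLp_noise := fun i k => (memLp_two_iff_integrable_sq (hA4_int i k).1).2 (hA4_int2 i k)
      integral_noise := fun i k => integral_eq_zero_of_condExp_eq_zero (hfilt k) (hA4_mds i k)
      integral_noise_sq_le := fun i k => integral_le_of_condExp_le (hfilt k) (hA4_bdd i k) }
  have hsa := hrec.isStochasticApproximation hβ.le
  have hT := hrec.integrable_operator 0
  set M : NetworkSpace (Fin N) HK →L[ℝ] NetworkSpace (Fin N) HK :=
    ∫ ω, T 0 ω ∂P + networkLaplacian A with hM
  have hsymm : ∀ x y, ⟪M x, y⟫ = ⟪x, M y⟫ := fun x y => by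
    rw [hM, add_apply, add_apply, inner_add_left, inner_add_right,
      inner_integral_samplingOperator_symm hT, inner_networkLaplacian_symm hA_symm]
  have hpos : ∀ x ≠ 0, 0 < ⟪M x, x⟫ := fun x hx =>
    inner_add_networkLaplacian_pos hA_symm hA_nonneg hconn
      (inner_integral_samplingOperator_self_nonneg hT)
      (fun g hg => by
        rw [inner_integral_samplingOperator_const hT hKK_int]
        exact hcov_pos g hg) hx
  have hc0 : ∀ k, 0 ≤ |b k - a k| * ‖(networkLaplacian A : NetworkSpace (Fin N) HK →L[ℝ] _)‖ :=
    fun k => by positivity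
  have hcsum := (summable_abs_sub_of_le hC2a hC2b fun k =>
    (le_max_right _ _).trans (hC k)).mul_right
      ‖(networkLaplacian A : NetworkSpace (Fin N) HK →L[ℝ] _)‖
  have hle : ∀ i k ω, ‖f i k ω - f₀‖ ≤ ‖e k ω‖ := fun i k ω => NetworkSpace.norm_coord_le (e k ω) i
  refine ⟨fun i => tendsto_lintegral_nnnorm_sq
    (fun k => (hrec.memLp k).integrable_norm_pow two_ne_zero) (hle i)
    (hsa.tendsto_integral_norm_sq hsymm hpos ha_pos hC3a hC2a hc0 hcsum (by positivity)),
    fun i => ?_⟩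
  filter_upwards [hsa.ae_tendsto_norm hsymm hpos ha_pos hC3a hC2a hc0 hcsum (by positivity)]
    with ω hω
  exact squeeze_zero (fun _ => norm_nonneg _) (fun k => hle i k ω) hω
end
end

section
/- Let f : Ω → X be a random element with values in the Banach space (X, norm topology), i.e., f is strongly measurable, and let T : Ω → L(X, Y) be a random element with values in L(X, Y) equipped with the strong operator topology, i.e., T is measurable with respect to the Borel σ-algebra of the strong operator topology and almost separably valued in that topology. Then the map ω ↦ T(ω) f(ω) is measurable with respect to the σ-algebra (⋁_{x∈X} σ(Tx)) ⋁ σ(f): for every Borel set B of (Y, norm topology), the preimage {ω : T(ω)f(ω) ∈ B} belongs to the σ-algebra generated by all sets (Tx)⁻¹(B') (x ∈ X, B' Borel in Y) together with all sets f⁻¹(B'') (B'' Borel in X). -/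
open MeasureTheory

noncomputable section

/-- The strong operator topology on `X →L[ℝ] Y`: the topology induced by the
pointwise-convergence topology on `X → Y`. -/
def sotTop (X Y : Type*) [NormedAddCommGroup X] [NormedSpace ℝ X]
    [NormedAddCommGroup Y] [NormedSpace ℝ Y] : TopologicalSpace (X →L[ℝ] Y) :=
  TopologicalSpace.induced (fun (T : X →L[ℝ] Y) (x : X) => T x)
    (inferInstance : TopologicalSpace (X → Y))

/-- The Borel σ-algebra of the strong operator topology on `X →L[ℝ] Y`. -/
def sotBorel (X Y : Type*) [NormedAddCommGroup X] [NormedSpace ℝ X]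
    [NormedAddCommGroup Y] [NormedSpace ℝ Y] : MeasurableSpace (X →L[ℝ] Y) :=
  @borel _ (sotTop X Y)

/-- Proposition A.2. Let `f : Ω → X` be a strongly measurable random element
with values in the Banach space `X`, and `T : Ω → L(X, Y)` a random element with respect to the
strong operator topology (Borel measurable for that topology and almost separably valued in it).
Then `ω ↦ T(ω) f(ω)` is measurable with respect to `(⋁_{x∈X} σ(Tx)) ⋁ σ(f)`. -/
theorem decentralized_online_learning.stmt9
    {Ω : Type*} [MeasurableSpace Ω] (P : Measure Ω) [IsProbabilityMeasure P]
    {X Y : Type*} [NormedAddCommGroup X] [NormedSpace ℝ X]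
    [NormedAddCommGroup Y] [NormedSpace ℝ Y]
    (f : Ω → X) (hf : StronglyMeasurable f)
    (T : Ω → (X →L[ℝ] Y))
    (hT_meas : @Measurable Ω (X →L[ℝ] Y) _ (sotBorel X Y) T)
    (hT_sep : ∃ U₀ : Set (X →L[ℝ] Y), @IsClosed _ (sotTop X Y) U₀ ∧
        @TopologicalSpace.IsSeparable _ (sotTop X Y) U₀ ∧ ∀ᵐ ω ∂P, T ω ∈ U₀) :
    @Measurable Ω Y
      ((⨆ x : X, MeasurableSpace.comap (fun ω => T ω x) (borel Y)) ⊔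
        MeasurableSpace.comap f (borel X))
      (borel Y) (fun ω => T ω (f ω)) := by
  let : MeasurableSpace X := borel X
  have : BorelSpace X := ⟨rfl⟩
  let : MeasurableSpace Y := borel Y
  have : BorelSpace Y := ⟨rfl⟩
  set m : MeasurableSpace Ω :=
    (⨆ x : X, MeasurableSpace.comap (fun ω => T ω x) (borel Y)) ⊔
      MeasurableSpace.comap f (borel X)
  have hTx : ∀ x, Measurable[m] (fun ω => T ω x) := fun x =>
    Measurable.mono (comap_measurable _)
      ((le_iSup (fun x : X => MeasurableSpace.comap (fun ω => T ω x) (borel Y)) x).trans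
        le_sup_left) le_rfl
  have hf_meas : StronglyMeasurable[m] f :=
    (@stronglyMeasurable_iff_measurable_separable _ _ _ m _ _ _).2
      ⟨Measurable.mono (comap_measurable f) le_sup_right le_rfl, hf.isSeparable_range⟩
  refine @measurable_of_tendsto_metrizable _ _ m _ _ _ _
    (fun n ω => T ω (hf_meas.approx n ω)) _
    (fun n => @SimpleFunc.measurable_bind _ _ _ m _ (hf_meas.approx n) (fun x ω => T ω x) hTx) ?_
  exact tendsto_pi_nhds.2 fun ω => ((T ω).continuous.tendsto _).comp (hf_meas.tendsto_approx ω)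
end
end

section
/- Let {f_k, k ≥ 1} be random elements with values in a topological space (X₁, τ₁) and {g_k, k ≥ 1} random elements with values in a topological space (X₂, τ₂), and suppose the σ-algebra ⋁_{i≥1} σ(f_i) is independent of the σ-algebra ⋁_{i≥1} σ(g_i). Then for every k ≥ 2, the σ-algebras 𝔉 = ⋁_{i≥k} σ(f_i) and 𝔊 = ⋁_{i≥k} σ(g_i) are conditionally independent given ℌ = ⋁_{i=1}^{k−1}(σ(f_i) ⋁ σ(g_i)): for every E ∈ 𝔉 and F ∈ 𝔊, E[1_{E∩F} | ℌ] = E[1_E | ℌ] · E[1_F | ℌ] almost surely. -/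
open MeasureTheory ProbabilityTheory

theorem MeasurableSpace.sup_eq_generateFrom_inter {Ω : Type*} (m₁ m₂ : MeasurableSpace Ω) :
    m₁ ⊔ m₂ = MeasurableSpace.generateFrom
      {s | ∃ A B, MeasurableSet[m₁] A ∧ MeasurableSet[m₂] B ∧ A ∩ B = s} := by
  refine le_antisymm (sup_le (fun A hA => ?_) (fun B hB => ?_))
    (MeasurableSpace.generateFrom_le ?_)
  · exact .basic _ ⟨A, Set.univ, hA, .univ, Set.inter_univ A⟩
  · exact .basic _ ⟨Set.univ, B, .univ, hB, Set.univ_inter B⟩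
  · rintro _ ⟨A, B, hA, hB, rfl⟩
    exact MeasurableSet.inter (m := m₁ ⊔ m₂) (le_sup_left (a := m₁) _ hA)
      (le_sup_right (b := m₂) _ hB)

theorem isPiSystem_inter_measurableSet {Ω : Type*} (m₁ m₂ : MeasurableSpace Ω) :
    IsPiSystem {s | ∃ A B, MeasurableSet[m₁] A ∧ MeasurableSet[m₂] B ∧ A ∩ B = s} := by
  rintro _ ⟨A, B, hA, hB, rfl⟩ _ ⟨A', B', hA', hB', rfl⟩ -
  exact ⟨A ∩ A', B ∩ B', hA.inter hA', hB.inter hB', Set.inter_inter_inter_comm A A' B B'⟩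

/-- Two integrable functions whose integrals agree on a π-system containing the whole space
have the same integral over every set of the generated σ-algebra. -/
theorem MeasureTheory.setIntegral_eq_of_isPiSystem {Ω : Type*} {m mΩ : MeasurableSpace Ω}
    {μ : Measure Ω} {u v : Ω → ℝ} {S : Set (Set Ω)} (hm : m ≤ mΩ)
    (h_eq : m = MeasurableSpace.generateFrom S) (hS : IsPiSystem S) (h_univ : Set.univ ∈ S)
    (hu : Integrable u μ) (hv : Integrable v μ)
    (h : ∀ s ∈ S, ∫ x in s, u x ∂μ = ∫ x in s, v x ∂μ) {s : Set Ω} (hs : MeasurableSet[m] s) :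
    ∫ x in s, u x ∂μ = ∫ x in s, v x ∂μ := by
  induction s, hs using MeasurableSpace.induction_on_inter h_eq hS with
  | empty => simp
  | basic t ht => exact h t ht
  | compl t ht ih =>
    have hu' := integral_add_compl (hm _ ht) hu
    have hv' := integral_add_compl (hm _ ht) hv
    have huniv := h _ h_univ
    rw [setIntegral_univ, setIntegral_univ] at huniv
    linarith
  | iUnion t hd ht ih =>
    rw [integral_iUnion (fun i => hm _ (ht i)) hd hu.integrableOn,
      integral_iUnion (fun i => hm _ (ht i)) hd hv.integrableOn]
    exact tsum_congr ih

theorem ProbabilityTheory.Indep.indepFun_of_measurable {Ω : Type*} {A B mΩ : MeasurableSpace Ω}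
    {μ : Measure Ω} (h : Indep A B μ) {φ ψ : Ω → ℝ}
    (hφ : Measurable[A] φ) (hψ : Measurable[B] ψ) : IndepFun φ ψ μ := by
  rw [IndepFun_iff_Indep]
  exact indep_of_indep_of_le_left (indep_of_indep_of_le_right h hψ.comap_le) hφ.comap_le

theorem ProbabilityTheory.Indep.setIntegral_inter_mul {Ω : Type*} {A B mΩ : MeasurableSpace Ω}
    {μ : Measure Ω} (hA : A ≤ mΩ) (hB : B ≤ mΩ) (h : Indep A B μ)
    {φ ψ : Ω → ℝ} (hφ : Measurable[A] φ) (hψ : Measurable[B] ψ) {s t : Set Ω}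
    (hs : MeasurableSet[A] s) (ht : MeasurableSet[B] t) :
    ∫ x in s ∩ t, φ x * ψ x ∂μ = (∫ x in s, φ x ∂μ) * ∫ x in t, ψ x ∂μ := by
  have hφs : Measurable[A] (s.indicator φ) := hφ.indicator hs
  have hψt : Measurable[B] (t.indicator ψ) := hψ.indicator ht
  have key := (h.indepFun_of_measurable hφs hψt).integral_fun_mul_eq_mul_integral
    (hφs.mono hA le_rfl).aestronglyMeasurable (hψt.mono hB le_rfl).aestronglyMeasurable
  rw [integral_indicator (hA _ hs), integral_indicator (hB _ ht)] at key
  rw [← key, ← integral_indicator ((hA _ hs).inter (hB _ ht))]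
  exact integral_congr_ae (.of_forall fun x => Set.inter_indicator_mul φ ψ x)

/-- If `A` and `B` are independent, then conditioning a product of an `A`-measurable and a
`B`-measurable function on `m₁ ⊔ m₂` with `m₁ ≤ A`, `m₂ ≤ B` factorizes. -/
theorem ProbabilityTheory.Indep.condExp_mul_sup {Ω : Type*} {m₁ m₂ A B mΩ : MeasurableSpace Ω}
    {μ : Measure Ω} [IsFiniteMeasure μ] (hA : A ≤ mΩ) (hB : B ≤ mΩ)
    (h : Indep A B μ) (h₁ : m₁ ≤ A) (h₂ : m₂ ≤ B) {φ ψ : Ω → ℝ}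
    (hφ : Measurable[A] φ) (hψ : Measurable[B] ψ) (hφi : Integrable φ μ) (hψi : Integrable ψ μ) :
    μ[fun x => φ x * ψ x | m₁ ⊔ m₂] =ᵐ[μ] fun x => (μ[φ | m₁]) x * (μ[ψ | m₂]) x := by
  have hm : m₁ ⊔ m₂ ≤ mΩ := sup_le (h₁.trans hA) (h₂.trans hB)
  have hu : Measurable[m₁] (μ[φ | m₁]) := stronglyMeasurable_condExp.measurable
  have hv : Measurable[m₂] (μ[ψ | m₂]) := stronglyMeasurable_condExp.measurable
  have hint : Integrable (fun x => φ x * ψ x) μ :=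
    (h.indepFun_of_measurable hφ hψ).integrable_mul hφi hψi
  have hint' : Integrable (fun x => (μ[φ | m₁]) x * (μ[ψ | m₂]) x) μ :=
    (h.indepFun_of_measurable (hu.mono h₁ le_rfl) (hv.mono h₂ le_rfl)).integrable_mul
      integrable_condExp integrable_condExp
  refine (ae_eq_condExp_of_forall_setIntegral_eq hm hint (fun s _ _ => hint'.integrableOn)
    (fun s hs _ => ?_) ?_).symm
  · refine setIntegral_eq_of_isPiSystem hm (MeasurableSpace.sup_eq_generateFrom_inter m₁ m₂)
      (isPiSystem_inter_measurableSet m₁ m₂)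
      ⟨Set.univ, Set.univ, .univ, .univ, Set.univ_inter _⟩ hint' hint ?_ hs
    rintro _ ⟨s, t, hs, ht, rfl⟩
    rw [h.setIntegral_inter_mul hA hB hφ hψ (h₁ _ hs) (h₂ _ ht),
      h.setIntegral_inter_mul hA hB (hu.mono h₁ le_rfl) (hv.mono h₂ le_rfl) (h₁ _ hs) (h₂ _ ht),
      setIntegral_condExp (h₁.trans hA) hφi hs, setIntegral_condExp (h₂.trans hB) hψi ht]
  · exact (Measurable.mul (m := m₁ ⊔ m₂) (hu.mono le_sup_left le_rfl)
      (hv.mono le_sup_right le_rfl)).stronglyMeasurable.aestronglyMeasurable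

/-- If `A` and `B` are independent, then they are conditionally independent given `m₁ ⊔ m₂`
whenever `m₁ ≤ A` and `m₂ ≤ B`. -/
theorem ProbabilityTheory.Indep.condExp_indicator_inter_sup {Ω : Type*}
    {m₁ m₂ A B mΩ : MeasurableSpace Ω} {μ : Measure Ω} [IsFiniteMeasure μ]
    (hA : A ≤ mΩ) (hB : B ≤ mΩ) (h : Indep A B μ) (h₁ : m₁ ≤ A) (h₂ : m₂ ≤ B) {s t : Set Ω}
    (hs : MeasurableSet[A] s) (ht : MeasurableSet[B] t) :
    μ[(s ∩ t).indicator (fun _ => (1 : ℝ)) | m₁ ⊔ m₂] =ᵐ[μ] fun x =>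
      (μ[s.indicator (fun _ => (1 : ℝ)) | m₁ ⊔ m₂]) x *
        (μ[t.indicator (fun _ => (1 : ℝ)) | m₁ ⊔ m₂]) x := by
  have hφ : Measurable[A] (s.indicator fun _ => (1 : ℝ)) := measurable_const.indicator hs
  have hψ : Measurable[B] (t.indicator fun _ => (1 : ℝ)) := measurable_const.indicator ht
  have hφi : Integrable (s.indicator fun _ => (1 : ℝ)) μ :=
    (integrable_const 1).indicator (hA _ hs)
  have hψi : Integrable (t.indicator fun _ => (1 : ℝ)) μ :=
    (integrable_const 1).indicator (hB _ ht)
  have hst := h.condExp_mul_sup hA hB h₁ h₂ hφ hψ hφi hψi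
  have hs' := h.condExp_mul_sup hA hB h₁ h₂ hφ measurable_const hφi (integrable_const (1 : ℝ))
  have ht' := h.condExp_mul_sup hA hB h₁ h₂ measurable_const hψ (integrable_const (1 : ℝ)) hψi
  simp only [mul_one, one_mul, condExp_const (h₁.trans hA), condExp_const (h₂.trans hB)]
    at hs' ht'
  have hmul : (s ∩ t).indicator (fun _ => (1 : ℝ)) =
      fun x => s.indicator (fun _ => (1 : ℝ)) x * t.indicator (fun _ => (1 : ℝ)) x := by
    ext x
    rw [← Set.inter_indicator_mul, mul_one]
  rw [hmul]
  filter_upwards [hst, hs', ht'] with x h1 h2 h3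
  rw [h1, h2, h3]

/-- Proposition A.7. If the family of random elements `{f_k}` with values in
a topological space `(X₁, τ₁)` and the family `{g_k}` with values in `(X₂, τ₂)` are independent,
then for every `k ≥ 1`, `⋁_{i≥k} σ(f_i)` and `⋁_{i≥k} σ(g_i)` are conditionally independent
given `⋁_{i<k} (σ(f_i) ⋁ σ(g_i))`. (Indices are shifted to start at `0`.) -/
theorem decentralized_online_learning.stmt11
    {Ω : Type*} [mΩ : MeasurableSpace Ω] (P : Measure Ω) [IsProbabilityMeasure P]
    {X₁ X₂ : Type*} [TopologicalSpace X₁] [TopologicalSpace X₂]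
    (f : ℕ → Ω → X₁) (g : ℕ → Ω → X₂)
    (hf_meas : ∀ i, @Measurable Ω X₁ mΩ (borel X₁) (f i))
    (hg_meas : ∀ i, @Measurable Ω X₂ mΩ (borel X₂) (g i))
    (hindep : Indep (⨆ i, MeasurableSpace.comap (f i) (borel X₁))
        (⨆ i, MeasurableSpace.comap (g i) (borel X₂)) P) :
    ∀ k : ℕ, 1 ≤ k → ∀ E F : Set Ω,
      MeasurableSet[⨆ i ∈ {i : ℕ | k ≤ i}, MeasurableSpace.comap (f i) (borel X₁)] E →
      MeasurableSet[⨆ i ∈ {i : ℕ | k ≤ i}, MeasurableSpace.comap (g i) (borel X₂)] F →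
      P[(E ∩ F).indicator (fun _ => (1 : ℝ)) |
          ⨆ i ∈ Finset.range k,
            (MeasurableSpace.comap (f i) (borel X₁) ⊔ MeasurableSpace.comap (g i) (borel X₂))]
        =ᵐ[P] fun ω =>
          ((P[E.indicator (fun _ => (1 : ℝ)) |
            ⨆ i ∈ Finset.range k,
              (MeasurableSpace.comap (f i) (borel X₁) ⊔
                MeasurableSpace.comap (g i) (borel X₂))]) ω) *
          ((P[F.indicator (fun _ => (1 : ℝ)) |
            ⨆ i ∈ Finset.range k,
              (MeasurableSpace.comap (f i) (borel X₁) ⊔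
                MeasurableSpace.comap (g i) (borel X₂))]) ω) := by
  intro k _ E F hE hF
  have hsup : (⨆ i ∈ Finset.range k,
      (MeasurableSpace.comap (f i) (borel X₁) ⊔ MeasurableSpace.comap (g i) (borel X₂))) =
      (⨆ i ∈ Finset.range k, MeasurableSpace.comap (f i) (borel X₁)) ⊔
        ⨆ i ∈ Finset.range k, MeasurableSpace.comap (g i) (borel X₂) := by
    simp only [iSup_sup_eq]
  rw [hsup]
  exact hindep.condExp_indicator_inter_sup
    (iSup_le fun i => @Measurable.comap_le _ _ mΩ (borel X₁) _ (hf_meas i))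
    (iSup_le fun i => @Measurable.comap_le _ _ mΩ (borel X₂) _ (hg_meas i))
    (iSup₂_le fun i _ => le_iSup (fun i => MeasurableSpace.comap (f i) (borel X₁)) i)
    (iSup₂_le fun i _ => le_iSup (fun i => MeasurableSpace.comap (g i) (borel X₂)) i)
    (iSup₂_le (fun i _ => le_iSup (fun i => MeasurableSpace.comap (f i) (borel X₁)) i) _ hE)
    (iSup₂_le (fun i _ => le_iSup (fun i => MeasurableSpace.comap (g i) (borel X₂)) i) _ hF)
end

section
/- Let X be a real Hilbert space, H ∈ L(X) a strictly positive self-adjoint bounded operator (H* = H and ⟨Hx, x⟩ > 0 for all x ≠ 0), and {μ(k), k ≥ 0} a sequence of positive reals monotonically decreasing to 0 with ∑_{k=0}^∞ μ(k) = ∞. Then there exist constants M > 0 and d > 0 such that sup_{s ≥ t} ‖(∏_{j=t}^s (I − μ(j)H)) x‖ ≤ M^d ‖x‖ for all x ∈ X and all t ≥ 0, and moreover lim_{k→∞} (∏_{j=0}^k (I − μ(j)H)) x = 0 for every x ∈ X, where ∏_{j=t}^s (I − μ(j)H) denotes the composition (I − μ(s)H)(I − μ(s−1)H)⋯(I − μ(t)H).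 -/
open Filter RealInnerProductSpace

noncomputable section

/-- The ordered product `A(s) ∘ A(s−1) ∘ ⋯ ∘ A(t)` (the identity when the index range is empty). -/
def opProdIcc {E : Type*} [NormedAddCommGroup E] [NormedSpace ℝ E]
    (A : ℕ → E →L[ℝ] E) (t s : ℕ) : E →L[ℝ] E :=
  (((List.range' t (s + 1 - t)).reverse).map A).prod

theorem opProdIcc_self {E : Type*} [NormedAddCommGroup E] [NormedSpace ℝ E]
    (A : ℕ → E →L[ℝ] E) (t : ℕ) : opProdIcc A t t = A t := by
  simp [opProdIcc]

theorem opProdIcc_succ {E : Type*} [NormedAddCommGroup E] [NormedSpace ℝ E]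
    (A : ℕ → E →L[ℝ] E) {t s : ℕ} (h : t ≤ s) :
    opProdIcc A t (s + 1) = A (s + 1) * opProdIcc A t s := by
  have h1 : s + 1 + 1 - t = (s + 1 - t) + 1 := by omega
  have h2 : t + (s + 1 - t) = s + 1 := by omega
  simp [opProdIcc, h1, List.range'_1_concat, h2]

/-- Factors bounded by `M`, all but the first `d` of which are contractions, have products bounded
by `M ^ d`. -/
theorem norm_opProdIcc_apply_le {E : Type*} [NormedAddCommGroup E] [NormedSpace ℝ E]
    {A : ℕ → E →L[ℝ] E} {M : ℝ} {d : ℕ} (hM : 1 ≤ M) (hA : ∀ j x, ‖A j x‖ ≤ M * ‖x‖)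
    (hd : ∀ j, d ≤ j → ∀ x, ‖A j x‖ ≤ ‖x‖) {t s : ℕ} (h : t ≤ s) (x : E) :
    ‖opProdIcc A t s x‖ ≤ M ^ d * ‖x‖ := by
  suffices ‖opProdIcc A t s x‖ ≤ M ^ min d (s + 1) * ‖x‖ from
    this.trans (by gcongr; exacts [min_le_left _ _])
  induction s, h using Nat.le_induction with
  | base =>
    rw [opProdIcc_self]
    rcases le_or_gt d t with hdt | hdt
    · exact (hd t hdt x).trans
        (le_mul_of_one_le_left (norm_nonneg x) (one_le_pow₀ hM))
    · exact (hA t x).trans (by gcongr; exact le_self_pow₀ hM (by omega))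
  | succ s hs ih =>
    rw [opProdIcc_succ A hs, mul_apply_eq_comp]
    rcases le_or_gt d (s + 1) with hds | hds
    · rw [min_eq_left hds] at ih
      rw [min_eq_left (by omega)]
      exact (hd _ hds _).trans ih
    · rw [min_eq_right hds.le] at ih
      rw [min_eq_right (by omega), pow_succ' M (s + 1), mul_assoc]
      exact (hA _ _).trans (by gcongr)

theorem opProdIcc_apply_comm {E : Type*} [NormedAddCommGroup E] [NormedSpace ℝ E]
    {A : ℕ → E →L[ℝ] E} {B : E →L[ℝ] E} (hAB : ∀ j x, A j (B x) = B (A j x)) {t s : ℕ}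
    (h : t ≤ s) (x : E) : opProdIcc A t s (B x) = B (opProdIcc A t s x) := by
  induction s, h using Nat.le_induction with
  | base => simp [opProdIcc_self, hAB]
  | succ s hs ih => simp [opProdIcc_succ A hs, ih, hAB]

/-- A nonnegative antitone sequence whose sum against a non-summable nonnegative weight is
controlled by telescoping differences of a nonnegative sequence tends to zero. -/
theorem tendsto_zero_of_mul_le_sub {a b ν : ℕ → ℝ} (ha : Antitone a) (ha0 : ∀ k, 0 ≤ a k)
    (hb0 : ∀ k, 0 ≤ b k) (hν0 : ∀ k, 0 ≤ ν k) (hν : ¬ Summable ν)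
    (hab : ∀ k, ν k * a k ≤ b k - b (k + 1)) : Tendsto a atTop (nhds 0) := by
  have hbdd : BddBelow (Set.range a) := ⟨0, by rintro _ ⟨k, rfl⟩; exact ha0 k⟩
  have hlim := tendsto_atTop_ciInf ha hbdd
  suffices h : (⨅ k, a k) ≤ 0 by
    rwa [le_antisymm h (le_ciInf ha0)] at hlim
  by_contra! hl
  refine hν ((summable_mul_right_iff hl.ne').1
    (summable_of_sum_range_le (c := b 0) (fun k => mul_nonneg (hν0 k) hl.le) fun n => ?_))
  calc ∑ k ∈ Finset.range n, ν k * (⨅ k, a k)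
      ≤ ∑ k ∈ Finset.range n, (b k - b (k + 1)) :=
        Finset.sum_le_sum fun k _ =>
          (mul_le_mul_of_nonneg_left (ciInf_le hbdd k) (hν0 k)).trans (hab k)
    _ = b 0 - b n := Finset.sum_range_sub' b n
    _ ≤ b 0 := sub_le_self _ (hb0 n)

section PositiveOperator

variable {X : Type*} [NormedAddCommGroup X] [InnerProductSpace ℝ X] {H : X →L[ℝ] X}

theorem norm_apply_sq_le_of_nonneg (hsa : ∀ x y : X, ⟪H x, y⟫ = ⟪x, H y⟫)
    (hpos : ∀ x : X, 0 ≤ ⟪H x, x⟫) {L : ℝ} (hL : 0 < L) (hHL : ‖H‖ ≤ L) (x : X) :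
    ‖H x‖ ^ 2 ≤ L * ⟪H x, x⟫ := by
  have h1 := hpos (L • x - H x)
  have h2 : ⟪H (H x), H x⟫ ≤ L * ‖H x‖ ^ 2 := by
    calc ⟪H (H x), H x⟫ ≤ ‖H (H x)‖ * ‖H x‖ := real_inner_le_norm _ _
      _ ≤ (L * ‖H x‖) * ‖H x‖ := by gcongr; exact H.le_of_opNorm_le hHL _
      _ = L * ‖H x‖ ^ 2 := by ring
  have h3 : ⟪H (L • x - H x), L • x - H x⟫
      = L * (L * ⟪H x, x⟫) - 2 * L * ‖H x‖ ^ 2 + ⟪H (H x), H x⟫ := by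
    simp only [map_sub, map_smul, inner_sub_left, inner_sub_right, real_inner_smul_left,
      real_inner_smul_right, hsa (H x) x, real_inner_self_eq_norm_sq]
    ring
  refine le_of_mul_le_mul_left ?_ hL
  linarith

theorem norm_one_sub_smul_apply_sq_le (hsa : ∀ x y : X, ⟪H x, y⟫ = ⟪x, H y⟫)
    (hpos : ∀ x : X, 0 ≤ ⟪H x, x⟫) {L c : ℝ} (hL : 0 < L) (hHL : ‖H‖ ≤ L) (hc : 0 ≤ c)
    (hcL : c * L ≤ 1) (x : X) :
    ‖(1 - c • H) x‖ ^ 2 ≤ ‖x‖ ^ 2 - c * ⟪H x, x⟫ := by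
  have h1 := norm_apply_sq_le_of_nonneg hsa hpos hL hHL x
  have h2 : c * (c * ‖H x‖ ^ 2) ≤ c * ⟪H x, x⟫ := by
    refine mul_le_mul_of_nonneg_left ?_ hc
    calc c * ‖H x‖ ^ 2 ≤ c * (L * ⟪H x, x⟫) := mul_le_mul_of_nonneg_left h1 hc
      _ = (c * L) * ⟪H x, x⟫ := by ring
      _ ≤ ⟪H x, x⟫ := mul_le_of_le_one_left (hpos x) hcL
  have h3 : (1 - c • H) x = x - c • H x := by simp
  rw [h3, norm_sub_sq_real, real_inner_smul_right, norm_smul, mul_pow, Real.norm_eq_abs, sq_abs,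
    real_inner_comm]
  nlinarith

theorem denseRange_of_inner_pos [CompleteSpace X] (hpos : ∀ x : X, x ≠ 0 → 0 < ⟪H x, x⟫) :
    DenseRange H := by
  suffices h : (LinearMap.range (H : X →ₗ[ℝ] X))ᗮ = ⊥ by
    have h' := Submodule.dense_iff_topologicalClosure_eq_top.2
      (Submodule.topologicalClosure_eq_top_iff.2 h)
    rwa [LinearMap.coe_range] at h'
  refine (Submodule.eq_bot_iff _).2 fun x hx => ?_
  by_contra hne
  exact (hpos x hne).ne' ((Submodule.mem_orthogonal _ x).1 hx (H x) ⟨x, rfl⟩)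

end PositiveOperator

/-- Lemma C.3. Let `X` be a real Hilbert space, `H ∈ L(X)` a strictly positive
self-adjoint bounded operator, and `{μ(k)}` positive reals monotonically decreasing to `0` with
`∑ μ(k) = ∞`. Then there exist `M > 0` and `d > 0` with
`sup_{s ≥ t} ‖(∏_{j=t}^s (I − μ(j)H)) x‖ ≤ M^d ‖x‖` for all `x` and `t`, and moreover
`(∏_{j=0}^k (I − μ(j)H)) x → 0` for every `x ∈ X`. -/
theorem decentralized_online_learning.stmt15
    {X : Type*} [NormedAddCommGroup X] [InnerProductSpace ℝ X] [CompleteSpace X]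
    (H : X →L[ℝ] X)
    (hH_sa : ∀ x y : X, ⟪H x, y⟫ = ⟪x, H y⟫)
    (hH_pos : ∀ x : X, x ≠ 0 → 0 < ⟪H x, x⟫)
    (μ : ℕ → ℝ)
    (hμ_pos : ∀ k, 0 < μ k) (hμ_anti : Antitone μ)
    (hμ_lim : Tendsto μ atTop (nhds 0))
    (hμ_div : ¬ Summable μ) :
    (∃ M > (0 : ℝ), ∃ d : ℕ, 0 < d ∧ ∀ t s : ℕ, t ≤ s → ∀ x : X,
        ‖opProdIcc (fun j => 1 - μ j • H) t s x‖ ≤ M ^ d * ‖x‖) ∧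
      ∀ x : X, Tendsto (fun k => opProdIcc (fun j => 1 - μ j • H) 0 k x) atTop (nhds 0) := by
  have hpos : ∀ x : X, 0 ≤ ⟪H x, x⟫ := fun x => by
    rcases eq_or_ne x 0 with rfl | hx
    · simp
    · exact (hH_pos x hx).le
  set A : ℕ → X →L[ℝ] X := fun j => 1 - μ j • H with hA
  set L : ℝ := ‖H‖ + 1 with hLdef
  have hL : 0 < L := by positivity
  have hHL : ‖H‖ ≤ L := by linarith
  obtain ⟨d, hd0, hd⟩ : ∃ d : ℕ, 0 < d ∧ ∀ j, d ≤ j → μ j * L ≤ 1 := by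
    have h : ∀ᶠ j in atTop, μ j * L < 1 :=
      (hμ_lim.mul_const L).eventually_lt_const (by simp)
    obtain ⟨d, hd⟩ := eventually_atTop.1 h
    exact ⟨d + 1, d.succ_pos, fun j hj => (hd j (by omega)).le⟩
  have hstep : ∀ j, d ≤ j → ∀ x, ‖A j x‖ ^ 2 ≤ ‖x‖ ^ 2 - μ j * ⟪H x, x⟫ := fun j hj x =>
    norm_one_sub_smul_apply_sq_le hH_sa hpos hL hHL (hμ_pos j).le (hd j hj) x
  have hcontr : ∀ j, d ≤ j → ∀ x, ‖A j x‖ ≤ ‖x‖ := fun j hj x =>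
    le_of_sq_le_sq ((hstep j hj x).trans
      (sub_le_self _ (mul_nonneg (hμ_pos j).le (hpos x)))) (norm_nonneg x)
  set M : ℝ := 1 + μ 0 * L with hMdef
  have hM : 1 ≤ M := le_add_of_nonneg_right (mul_nonneg (hμ_pos 0).le hL.le)
  have hAM : ∀ j x, ‖A j x‖ ≤ M * ‖x‖ := fun j x => by
    calc ‖A j x‖ = ‖x - μ j • H x‖ := by simp [hA]
      _ ≤ ‖x‖ + ‖μ j • H x‖ := norm_sub_le _ _
      _ = ‖x‖ + μ j * ‖H x‖ := by rw [norm_smul, Real.norm_of_nonneg (hμ_pos j).le]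
      _ ≤ ‖x‖ + μ 0 * (L * ‖x‖) := by
        have := (hμ_pos 0).le
        gcongr
        · exact hμ_anti j.zero_le
        · exact H.le_of_opNorm_le hHL x
      _ = M * ‖x‖ := by ring
  have hbound : ∀ t s : ℕ, t ≤ s → ∀ x : X, ‖opProdIcc A t s x‖ ≤ M ^ d * ‖x‖ :=
    fun t s h x => norm_opProdIcc_apply_le hM hAM hcontr h x
  refine ⟨⟨M, by linarith, d, hd0, hbound⟩, fun x => ?_⟩
  have hsucc : ∀ k y, opProdIcc A 0 (k + 1) y = A (k + 1) (opProdIcc A 0 k y) := fun k y => by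
    rw [opProdIcc_succ A k.zero_le, mul_apply_eq_comp]
  have hrange : ∀ y, Tendsto (fun k => opProdIcc A 0 k (H y)) atTop (nhds 0) := fun y => by
    have hcomm : ∀ k, opProdIcc A 0 k (H y) = H (opProdIcc A 0 k y) := fun k =>
      opProdIcc_apply_comm (fun j z => by simp [hA]) k.zero_le y
    have hsq : Tendsto (fun k => ‖opProdIcc A 0 (k + d) (H y)‖ ^ 2) atTop (nhds 0) := by
      refine tendsto_zero_of_mul_le_sub (b := fun k => L * ‖opProdIcc A 0 (k + d) y‖ ^ 2)
        (ν := fun k => μ (k + (d + 1))) (antitone_nat_of_succ_le fun k => ?_)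
        (fun k => by positivity) (fun k => by positivity) (fun k => (hμ_pos _).le)
        (fun h => hμ_div ((summable_nat_add_iff (d + 1)).1 h)) fun k => ?_
      · rw [add_right_comm, hsucc]
        gcongr
        exact hcontr _ (by omega) _
      · have h1 := norm_apply_sq_le_of_nonneg hH_sa hpos hL hHL (opProdIcc A 0 (k + d) y)
        have h2 := hstep (k + d + 1) (by omega) (opProdIcc A 0 (k + d) y)
        rw [add_right_comm k 1 d, hsucc, hcomm, ← add_assoc]
        have h3 := mul_le_mul_of_nonneg_left h1 (hμ_pos (k + d + 1)).le
        have h4 := mul_le_mul_of_nonneg_left h2 hL.le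
        linarith
    refine (tendsto_add_atTop_iff_nat d).1 (tendsto_zero_iff_norm_tendsto_zero.2 ?_)
    simpa using hsq.sqrt
  refine Metric.tendsto_atTop.2 fun ε hε => ?_
  have hC : 0 < M ^ d := by positivity
  obtain ⟨y, hy⟩ := (denseRange_of_inner_pos hH_pos).exists_dist_lt x
    (show 0 < ε / 2 / M ^ d by positivity)
  obtain ⟨N, hN⟩ := Metric.tendsto_atTop.1 (hrange y) (ε / 2) (half_pos hε)
  refine ⟨N, fun k hk => ?_⟩
  have h1 := hN k hk
  rw [dist_zero_right] at h1 ⊢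
  rw [dist_eq_norm, lt_div_iff₀' hC] at hy
  calc ‖opProdIcc A 0 k x‖
      = ‖opProdIcc A 0 k (x - H y) + opProdIcc A 0 k (H y)‖ := by rw [map_sub, sub_add_cancel]
    _ ≤ ‖opProdIcc A 0 k (x - H y)‖ + ‖opProdIcc A 0 k (H y)‖ := norm_add_le _ _
    _ < ε / 2 + ε / 2 := add_lt_add ((hbound 0 k k.zero_le _).trans_lt hy) h1
    _ = ε := add_halves ε
end
end

section
/- Let X be a real Hilbert space and N ≥ 1. Let 𝒜 = [a_{ij}] ∈ ℝ^{N×N} be the weighted adjacency matrix of an undirected connected graph: a_{ij} = a_{ji} ≥ 0, a_{ii} = 0, and the graph on {1, …, N} with edge set {(i,j) : a_{ij} > 0} is connected. Let L_𝒢 = D_𝒢 − 𝒜 be the Laplacian matrix with D_𝒢 = diag(∑_j a_{1j}, …, ∑_j a_{Nj}). Let H₁, …, H_N ∈ L(X) be positive self-adjoint operators such that ∑_{i=1}^N H_i is strictly positive (⟨(∑_i H_i)x, x⟩ > 0 for all x ≠ 0). Then the operator diag{H₁, …, H_N} + L_𝒢 ⊗ I_X on the Hilbert direct sum X^N, acting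 by x = (x₁, …, x_N) ↦ (H_i x_i + ∑_{j=1}^N (L_𝒢)_{ij} x_j)_{i=1,…,N}, is strictly positive: ⟨(diag{H₁,…,H_N} + L_𝒢 ⊗ I_X) x, x⟩_{X^N} > 0 for every nonzero x ∈ X^N. -/
open RealInnerProductSpace

/-- The quadratic form of a weighted graph Laplacian is half the weighted sum of the squared
distances. -/
theorem sum_inner_laplacian_eq {ι X : Type*} [Fintype ι] [DecidableEq ι]
    [NormedAddCommGroup X] [InnerProductSpace ℝ X] (A : ι → ι → ℝ)
    (hA : ∀ i j, A i j = A j i) (x : ι → X) :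
    ∑ i, ⟪∑ j, (((if i = j then ∑ l, A i l else 0) - A i j) • x j), x i⟫ =
      (1 / 2) * ∑ i, ∑ j, A i j * ‖x i - x j‖ ^ 2 := by
  have hswap : ∑ i, ∑ j, A i j * ‖x j‖ ^ 2 = ∑ i, ∑ j, A i j * ‖x i‖ ^ 2 := by
    rw [Finset.sum_comm]
    exact Finset.sum_congr rfl fun i _ => Finset.sum_congr rfl fun j _ => by rw [hA]
  have hrhs : ∑ i, ∑ j, A i j * ‖x i - x j‖ ^ 2 =
      ∑ i, ∑ j, A i j * ‖x i‖ ^ 2 - 2 * ∑ i, ∑ j, A i j * ⟪x j, x i⟫ +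
        ∑ i, ∑ j, A i j * ‖x j‖ ^ 2 := by
    simp only [Finset.mul_sum, ← Finset.sum_sub_distrib, ← Finset.sum_add_distrib]
    refine Finset.sum_congr rfl fun i _ => Finset.sum_congr rfl fun j _ => ?_
    rw [norm_sub_sq_real, real_inner_comm]
    ring
  have hlhs : ∑ i, ⟪∑ j, (((if i = j then ∑ l, A i l else 0) - A i j) • x j), x i⟫ =
      ∑ i, ∑ j, A i j * ‖x i‖ ^ 2 - ∑ i, ∑ j, A i j * ⟪x j, x i⟫ := by
    rw [← Finset.sum_sub_distrib]
    refine Finset.sum_congr rfl fun i _ => ?_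
    simp [sum_inner, real_inner_smul_left, sub_smul, inner_sub_left,
      Finset.sum_sub_distrib, Finset.sum_mul]
  rw [hlhs, hrhs, hswap]
  ring

/-- Lemma C.5. If `𝒜 = [a_{ij}]` is the weighted adjacency matrix of an
undirected connected graph with Laplacian `L_𝒢 = D_𝒢 − 𝒜`, and `H₁, …, H_N ∈ L(X)` are positive
self-adjoint operators on the real Hilbert space `X` with `∑ᵢ Hᵢ` strictly positive, then the
operator `diag{H₁,…,H_N} + L_𝒢 ⊗ I_X` on `X^N`, acting componentwise by
`x ↦ (Hᵢ xᵢ + ∑ⱼ (L_𝒢)_{ij} xⱼ)ᵢ`, is strictly positive. -/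
theorem decentralized_online_learning.stmt17
    {X : Type*} [NormedAddCommGroup X] [InnerProductSpace ℝ X] [CompleteSpace X]
    {N : ℕ} (hN : 0 < N)
    (A : Fin N → Fin N → ℝ)
    (hA_symm : ∀ i j, A i j = A j i)
    (hA_nonneg : ∀ i j, 0 ≤ A i j)
    (hA_diag : ∀ i, A i i = 0)
    (hconn : ∀ i j : Fin N, Relation.ReflTransGen (fun p q : Fin N => 0 < A p q) i j)
    (H : Fin N → X →L[ℝ] X)
    (hH_sa : ∀ i, ∀ x y : X, ⟪H i x, y⟫ = ⟪x, H i y⟫)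
    (hH_pos : ∀ i, ∀ x : X, 0 ≤ ⟪H i x, x⟫)
    (hsum_pos : ∀ x : X, x ≠ 0 → 0 < ⟪(∑ i, H i) x, x⟫) :
    ∀ x : PiLp 2 (fun _ : Fin N => X), x ≠ 0 →
      0 < ∑ i, ⟪H i (x i) + ∑ j, (((if i = j then ∑ l, A i l else 0) - A i j) • x j), x i⟫ := by
  intro x hx
  simp only [inner_add_left, Finset.sum_add_distrib]
  rw [sum_inner_laplacian_eq A hA_symm]
  have hterm : ∀ i j, 0 ≤ A i j * ‖x i - x j‖ ^ 2 := fun i j =>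
    mul_nonneg (hA_nonneg i j) (sq_nonneg _)
  have hrow : ∀ i, 0 ≤ ∑ j, A i j * ‖x i - x j‖ ^ 2 := fun i =>
    Finset.sum_nonneg fun j _ => hterm i j
  have hH : 0 ≤ ∑ i, ⟪H i (x i), x i⟫ := Finset.sum_nonneg fun i _ => hH_pos i _
  have hL : 0 ≤ ∑ i, ∑ j, A i j * ‖x i - x j‖ ^ 2 := Finset.sum_nonneg fun i _ => hrow i
  rcases hL.lt_or_eq with hL | hL
  · linarith
  have hedge : ∀ i j, 0 < A i j → x i = x j := by
    intro i j hij
    have h₁ := (Finset.sum_eq_zero_iff_of_nonneg fun i _ => hrow i).1 hL.symm i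
      (Finset.mem_univ i)
    have h₂ := (Finset.sum_eq_zero_iff_of_nonneg fun j _ => hterm i j).1 h₁ j
      (Finset.mem_univ j)
    simpa [hij.ne', sub_eq_zero] using h₂
  have hconst : ∀ i j, x i = x j := by
    intro i j
    induction hconn i j with
    | refl => rfl
    | tail _ hbc ih => exact ih.trans (hedge _ _ hbc)
  have hne : x ⟨0, hN⟩ ≠ 0 := fun h0 =>
    hx (PiLp.ext fun i => (hconst i ⟨0, hN⟩).trans h0)
  have hpos := hsum_pos _ hne
  rw [sum_apply, sum_inner] at hpos
  rw [← hL, mul_zero, add_zero]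
  convert hpos using 3 with i
  · rw [hconst i ⟨0, hN⟩]
  · exact hconst _ _
end

section
/- Let {a(k), k ≥ 0} and {b(k), k ≥ 0} be monotonically decreasing sequences of positive reals such that there exists C₁ > 0 with max{a(k) − a(k+1), |b(k) − a(k)|} ≤ C₁(a²(k) + b²(k)) for all k ≥ 0. Then for every positive integer h there exists a constant C > 0 such that for all i ≥ 0, max_{ih ≤ s ≤ (i+1)h−1} ((1/h)(∑_{s'=ih}^{(i+1)h−1} b(s')) − a(s))² ≤ C (a⁴(i) + b⁴(i)). -/
/-- If the decrements of `a` beyond `m` are bounded by `D`, then so are its decreases over `n`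
steps by `n * D`. -/
theorem sub_add_le_nat_mul {a : ℕ → ℝ} {m : ℕ} {D : ℝ}
    (hD : ∀ k, m ≤ k → a k - a (k + 1) ≤ D) (n : ℕ) :
    a m - a (m + n) ≤ n * D := by
  induction n with
  | zero => simp
  | succ n ih =>
    have h := hD (m + n) (Nat.le_add_right m n)
    rw [← add_assoc]
    push_cast
    linarith

/-- If every value of `f` on a nonempty finite set is within `D` of `c`, so is its average. -/
theorem abs_average_sub_le {ι : Type*} {t : Finset ι} (ht : t.Nonempty) {f : ι → ℝ} {c D : ℝ}
    (hf : ∀ j ∈ t, |f j - c| ≤ D) :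
    |(1 / (t.card : ℝ)) * (∑ j ∈ t, f j) - c| ≤ D := by
  have hpos : (0 : ℝ) < t.card := by exact_mod_cast ht.card_pos
  have heq : (1 / (t.card : ℝ)) * (∑ j ∈ t, f j) - c = (∑ j ∈ t, (f j - c)) / t.card := by
    rw [Finset.sum_sub_distrib, Finset.sum_const, nsmul_eq_mul]
    field_simp
  rw [heq, abs_div, abs_of_pos hpos, div_le_iff₀ hpos]
  calc |∑ j ∈ t, (f j - c)| ≤ ∑ j ∈ t, |f j - c| := Finset.abs_sum_le_sum_abs _ _
    _ ≤ t.card • D := Finset.sum_le_card_nsmul _ _ _ hf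
    _ = D * t.card := by rw [nsmul_eq_mul, mul_comm]

/-- Lemma C.6. If `{a(k)}` and `{b(k)}` are monotonically decreasing sequences
of positive reals with `max{a(k) − a(k+1), |b(k) − a(k)|} ≤ C₁(a²(k) + b²(k))`, then for every
positive integer `h` there is `C > 0` such that for every `i`,
`max_{ih ≤ s ≤ (i+1)h−1} ((1/h)(∑_{s'} b(s')) − a(s))² ≤ C (a⁴(i) + b⁴(i))`. -/
theorem decentralized_online_learning.stmt18
    (a b : ℕ → ℝ)
    (ha_pos : ∀ k, 0 < a k) (hb_pos : ∀ k, 0 < b k)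
    (ha_mono : Antitone a) (hb_mono : Antitone b)
    (C₁ : ℝ) (hC₁ : 0 < C₁)
    (hcond : ∀ k, max (a k - a (k + 1)) |b k - a k| ≤ C₁ * (a k ^ 2 + b k ^ 2)) :
    ∀ h : ℕ, 0 < h → ∃ C > (0 : ℝ), ∀ i : ℕ, ∀ s ∈ Finset.Ico (i * h) ((i + 1) * h),
      ((1 / (h : ℝ)) * (∑ s' ∈ Finset.Ico (i * h) ((i + 1) * h), b s') - a s) ^ 2
        ≤ C * (a i ^ 4 + b i ^ 4) := by
  intro h hh
  refine ⟨2 * ((h + 1) * C₁) ^ 2, by positivity, fun i s hs => ?_⟩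
  set D : ℝ := C₁ * (a i ^ 2 + b i ^ 2) with hD
  have hD0 : 0 ≤ D := by positivity
  have him : i ≤ i * h := Nat.le_mul_of_pos_right i hh
  have hbound : ∀ k, i * h ≤ k → a k - a (k + 1) ≤ D ∧ |b k - a k| ≤ D := by
    intro k hk
    have hle : C₁ * (a k ^ 2 + b k ^ 2) ≤ D := by
      have h₁ := ha_mono (him.trans hk)
      have h₂ := hb_mono (him.trans hk)
      have h₃ := (ha_pos k).le
      have h₄ := (hb_pos k).le
      rw [hD]
      gcongr
    exact max_le_iff.1 ((hcond k).trans hle)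
  have hblock : ∀ k ∈ Finset.Ico (i * h) ((i + 1) * h),
      a k ≤ a (i * h) ∧ a (i * h) - a k ≤ h * D := by
    intro k hk
    rw [Finset.mem_Ico, add_mul, one_mul] at hk
    refine ⟨ha_mono hk.1, ?_⟩
    obtain ⟨n, rfl⟩ := Nat.exists_eq_add_of_le hk.1
    have hn : (n : ℝ) ≤ h := by exact_mod_cast (by omega : n ≤ h)
    exact (sub_add_le_nat_mul (fun k hk => (hbound k hk).1) n).trans (by gcongr)
  have hdiff : ∀ k ∈ Finset.Ico (i * h) ((i + 1) * h), |b k - a s| ≤ (h + 1) * D := by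
    intro k hk
    have h₁ := abs_le.1 (hbound k (Finset.mem_Ico.1 hk).1).2
    have h₂ := hblock k hk
    have h₃ := hblock s hs
    rw [abs_le]
    constructor <;> linarith
  have havg := abs_average_sub_le ⟨s, hs⟩ hdiff
  have hcard : (Finset.Ico (i * h) ((i + 1) * h)).card = h := by
    rw [Nat.card_Ico, add_mul, one_mul, Nat.add_sub_cancel_left]
  rw [hcard] at havg
  calc _ ≤ ((h + 1) * D) ^ 2 := sq_le_sq' (abs_le.1 havg).1 (abs_le.1 havg).2
    _ = ((h + 1) * C₁) ^ 2 * (a i ^ 2 + b i ^ 2) ^ 2 := by rw [hD]; ring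
    _ ≤ ((h + 1) * C₁) ^ 2 * (2 * (a i ^ 4 + b i ^ 4)) := by
      gcongr
      linarith [sq_nonneg (a i ^ 2 - b i ^ 2)]
    _ = _ := by ring
end
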